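/- Let L(ℓ₂) denote the complex Banach space of all bounded linear operators on the complex Hilbert space ℓ₂ of square-summable complex sequences, equipped with the operator norm. Then no bounded linear operator on L(ℓ₂) is topologically transitive. -/

import Mathlib

/-- A bounded linear operator `T` on a complex Banach space `X` is topologically transitive
if for every pair `U, V` of nonempty open subsets of `X` there is a positive integer `n`
with `T^n(U) ∩ V ≠ ∅`. -/
def TopologicallyTransitive {X : Type*} [NormedAddCommGroup X] [NormedSpace ℂ X]
    (T : X →L[ℂ] X) : Prop :=
  ∀ U V : Set X, IsOpen U → IsOpen V → U.Nonempty → V.Nonempty →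
    ∃ n : ℕ, 0 < n ∧ ((T ^ n) '' U ∩ V).Nonempty

section Auxiliary
open Filter Topology NormedSpace

/-- Goldstine's theorem for finitely many functionals. -/
theorem exists_norm_le_one_forall_finset_norm_sub_lt {X : Type*} [NormedAddCommGroup X]
    [NormedSpace ℂ X] (z : StrongDual ℂ (StrongDual ℂ X)) (hz : ‖z‖ ≤ 1)
    (F : Finset (StrongDual ℂ X)) {η : ℝ} (hη : 0 < η) :
    ∃ x : X, ‖x‖ ≤ 1 ∧ ∀ φ ∈ F, ‖φ x - z φ‖ < η := by
  classical
  let L : X →L[ℂ] (F → ℂ) := ContinuousLinearMap.pi fun φ => φ.1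
  let p : F → ℂ := fun φ => z φ.1
  have hconv : Convex ℝ (L '' Metric.closedBall (0 : X) 1) :=
    (convex_closedBall (0 : X) 1).is_linear_image
      (L.toLinearMap.restrictScalars ℝ).isLinear
  have hp : p ∈ closure (L '' Metric.closedBall (0 : X) 1) := by
    by_contra hp
    obtain ⟨f, u, hfu, hup⟩ := RCLike.geometric_hahn_banach_closed_point (𝕜 := ℂ)
      hconv.closure isClosed_closure hp
    have hf : ∀ q : F → ℂ, f q = ∑ φ, q φ • f (Pi.single φ 1) := fun q => by
      conv_lhs => rw [pi_eq_sum_univ' q]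
      simp [map_sum]
    let Φ : StrongDual ℂ X := f.comp L
    have hzΦ : z Φ = f p := by
      have : Φ = ∑ φ : F, f (Pi.single φ 1) • φ.1 := by
        ext x
        simp only [Φ, ContinuousLinearMap.comp_apply, hf (L x), sum_apply,
          smul_apply, smul_eq_mul, mul_comm]
        rfl
      rw [this, hf p]
      simp [p, mul_comm]
    have hΦ : ‖Φ‖ ≤ u := by
      have h0 : 0 ≤ u := by
        have := hfu (L 0) (subset_closure ⟨0, by simp, rfl⟩)
        simpa using this.le
      refine ContinuousLinearMap.opNorm_le_of_unit_norm h0 fun x hx => ?_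
      obtain ⟨c, hc, hcx⟩ := RCLike.exists_norm_eq_mul_self (Φ x)
      have h1 := hfu (L (c • x)) (subset_closure ⟨c • x, by simp [norm_smul, hc, hx], rfl⟩)
      have h2 : f (L (c • x)) = (‖Φ x‖ : ℂ) := by
        rw [map_smul, map_smul, smul_eq_mul]
        exact hcx.symm
      rw [h2] at h1
      simpa using h1.le
    have h1 : (z Φ).re ≤ u := calc
      (z Φ).re ≤ ‖z Φ‖ := Complex.re_le_norm _
      _ ≤ ‖z‖ * ‖Φ‖ := z.le_opNorm Φ
      _ ≤ 1 * u := by gcongr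
      _ = u := one_mul u
    rw [hzΦ] at h1
    exact absurd hup (not_lt.2 h1)
  obtain ⟨_, ⟨x, hx, rfl⟩, hxp⟩ := Metric.mem_closure_iff.1 hp η hη
  refine ⟨x, by simpa using hx, fun φ hφ => ?_⟩
  have := (dist_pi_lt_iff hη).1 hxp ⟨φ, hφ⟩
  rw [dist_comm, dist_eq_norm] at this
  exact this

/-- A functional that is small on the unit vectors `e` with `A e` small is the sum of a small
functional and a bounded functional of `A e`. -/
theorem exists_eq_add_comp_of_norm_le {E : Type*} [NormedAddCommGroup E] [NormedSpace ℂ E]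
    (A : E →L[ℂ] E) (w : StrongDual ℂ E) {r δ : ℝ} (hr : 0 < r) (hδ : 0 ≤ δ)
    (hw : ∀ e : E, ‖e‖ ≤ 1 → ‖A e‖ ≤ r → ‖w e‖ ≤ δ) :
    ∃ z y : StrongDual ℂ E, ‖z‖ ≤ δ ∧ ‖y‖ ≤ r⁻¹ * δ ∧ ∀ e, w e = z e + y (A e) := by
  let R : E →L[ℂ] E × E := (ContinuousLinearMap.id ℂ _).prod ((r⁻¹ : ℂ) • A)
  let p : Submodule ℂ (E × E) := LinearMap.range R.toLinearMap
  let f : StrongDual ℂ p := (w.comp (ContinuousLinearMap.fst ℂ _ _)).comp p.subtypeL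
  have hf : ‖f‖ ≤ δ := by
    refine ContinuousLinearMap.opNorm_le_of_unit_norm hδ ?_
    rintro ⟨_, e, rfl⟩ hu
    have hu' : ‖R e‖ = 1 := hu
    refine hw e (hu' ▸ norm_fst_le (R e)) ?_
    have h2 : ‖(R e).2‖ ≤ 1 := hu' ▸ norm_snd_le (R e)
    have h3 : (R e).2 = (r⁻¹ : ℂ) • A e := rfl
    rw [h3, norm_smul, norm_inv, Complex.norm_real, Real.norm_of_nonneg hr.le,
      inv_mul_le_iff₀ hr, mul_one] at h2
    exact h2
  obtain ⟨g, hgf, hg⟩ := exists_extension_norm_eq p f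
  rw [← hg] at hf
  refine ⟨g.comp (ContinuousLinearMap.inl ℂ _ _),
    (r⁻¹ : ℂ) • g.comp (ContinuousLinearMap.inr ℂ _ _), ?_, ?_, fun e => ?_⟩
  · refine ContinuousLinearMap.opNorm_le_bound _ hδ fun e => ?_
    refine (g.le_opNorm (e, 0)).trans ?_
    rw [Prod.norm_mk, norm_zero, max_eq_left (norm_nonneg e)]
    gcongr
  · rw [norm_smul, norm_inv, Complex.norm_real, Real.norm_of_nonneg hr.le]
    gcongr
    refine ContinuousLinearMap.opNorm_le_bound _ hδ fun e => ?_
    refine (g.le_opNorm (0, e)).trans ?_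
    rw [Prod.norm_mk, norm_zero, max_eq_right (norm_nonneg e)]
    gcongr
  · have h1 : g (R e) = w e := hgf ⟨R e, e, rfl⟩
    have h2 : R e = (e, 0) + (r⁻¹ : ℂ) • (0, A e) := by
      ext <;> simp [R]
    rw [← h1, h2, map_add, map_smul]
    rfl

/-- A bounded operator on a nonzero complex Banach space cannot be such that all its translates by
scalars are almost open. -/
theorem exists_not_almost_open_sub_smul {Q : Type*} [NormedAddCommGroup Q] [NormedSpace ℂ Q]
    [CompleteSpace Q] [Nontrivial Q] (t : Q →L[ℂ] Q) :
    ∃ c : ℂ, ∀ M : ℝ, ∃ q : Q, ‖q‖ ≤ 1 ∧ ∀ q' : Q, ‖q'‖ ≤ M → 1 / 2 < ‖q - (t q' - c • q')‖ := by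
  by_contra! H
  obtain ⟨c, hc⟩ : (frontier (spectrum ℂ t)).Nonempty := by
    rw [nonempty_frontier_iff]
    refine ⟨spectrum.nonempty t, fun h => ?_⟩
    have := (spectrum.isCompact (𝕜 := ℂ) t).isBounded
    rw [h] at this
    exact NormedSpace.unbounded_univ ℂ ℂ this
  rw [frontier_eq_closure_inter_closure, (spectrum.isClosed t).closure_eq] at hc
  obtain ⟨hcσ, hcl⟩ := hc
  obtain ⟨M₀, hM₀⟩ := H c
  set M := max M₀ 1
  have hM1 : 1 ≤ M := le_max_right _ _
  obtain ⟨μ, hμ, hμc⟩ := Metric.mem_closure_iff.1 hcl (1 / (8 * M)) (by positivity)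
  rw [dist_eq_norm, lt_div_iff₀ (by positivity)] at hμc
  obtain ⟨u, hu⟩ : IsUnit (algebraMap ℂ (Q →L[ℂ] Q) μ - t) := not_not.1 hμ
  let R : Q →L[ℂ] Q := ↑u⁻¹
  have hR : ∀ q, R (μ • q - t q) = q := fun q => by
    have h : R * (algebraMap ℂ (Q →L[ℂ] Q) μ - t) = 1 := by rw [← hu]; exact u.inv_mul
    have := congrArg (fun f : Q →L[ℂ] Q => f q) h
    simpa [Algebra.algebraMap_eq_smul_one] using this
  have hbound : ‖R‖ ≤ M + ‖c - μ‖ * (M * ‖R‖) + ‖R‖ * (1 / 2) := by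
    refine ContinuousLinearMap.opNorm_le_of_unit_norm (by positivity) fun q hq => ?_
    obtain ⟨q', hq', he⟩ := hM₀ q hq.le
    replace hq' : ‖q'‖ ≤ M := hq'.trans (le_max_left _ _)
    have e : R q = -q' - (c - μ) • R q' + R (q - (t q' - c • q')) := by
      have h1 := hR q'
      rw [map_sub, map_smul] at h1
      rw [map_sub, map_sub, map_smul, sub_smul]
      nth_rw 1 [← h1]
      abel
    rw [e]
    refine (norm_add_le _ _).trans ?_
    gcongr
    · refine (norm_sub_le _ _).trans ?_
      rw [norm_neg, norm_smul]
      gcongr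
      rw [mul_comm]
      exact (R.le_opNorm q').trans (by gcongr)
    · exact (R.le_opNorm _).trans (by gcongr)
  have h8 : ‖c - μ‖ * (M * ‖R‖) ≤ ‖R‖ / 8 := by nlinarith [norm_nonneg R]
  have hR4 : ‖R‖ ≤ 4 * M := by linarith
  have hlt : ‖(c - μ) • R‖ < 1 := by
    rw [norm_smul]
    nlinarith [norm_nonneg (c - μ)]
  refine hcσ ?_
  have hfac : algebraMap ℂ (Q →L[ℂ] Q) c - t = (u : Q →L[ℂ] Q) * (1 - (-((c - μ) • R))) := by
    have h : (u : Q →L[ℂ] Q) * R = 1 := u.mul_inv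
    rw [sub_neg_eq_add, mul_add, mul_one, mul_smul_comm, h, hu, sub_smul,
      Algebra.algebraMap_eq_smul_one, Algebra.algebraMap_eq_smul_one]
    abel
  change IsUnit (algebraMap ℂ (Q →L[ℂ] Q) c - t)
  rw [hfac]
  exact u.isUnit.mul (isUnit_one_sub_of_norm_lt_one (by rwa [norm_neg]))

/-- Quotient form of `exists_not_almost_open_sub_smul`. -/
theorem exists_not_almost_open_sub_smul_mod {W : Type*} [NormedAddCommGroup W] [NormedSpace ℂ W]
    [CompleteSpace W] (p : Submodule ℂ W) (hp : IsClosed (p : Set W)) (hp' : p ≠ ⊤) (A : W →L[ℂ] W)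
    (hA : ∀ w ∈ p, A w ∈ p) :
    ∃ c : ℂ, ∀ M : ℝ, ∃ w : W, ‖w‖ ≤ 2 ∧
      ∀ w' : W, ‖w'‖ ≤ M → ∀ y ∈ p, 1 / 2 < ‖w - (A w' - c • w') - y‖ := by
  have : IsClosed (p : Set W) := hp
  have : Nontrivial (W ⧸ p) := Submodule.Quotient.nontrivial_iff.2 hp'
  let t : (W ⧸ p) →L[ℂ] (W ⧸ p) :=
    p.liftQL (p.mkQL.comp A) fun w hw => (Submodule.Quotient.mk_eq_zero p).2 (hA w hw)
  obtain ⟨c, hc⟩ := exists_not_almost_open_sub_smul t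
  refine ⟨c, fun M => ?_⟩
  obtain ⟨q, hq, hq'⟩ := hc M
  obtain ⟨w, rfl, hw⟩ := Submodule.Quotient.norm_mk_lt q one_pos
  refine ⟨w, by linarith, fun w' hw' y hy => ?_⟩
  refine (hq' (Submodule.Quotient.mk w')
    ((Submodule.Quotient.norm_mk_le p w').trans hw')).trans_le ?_
  have h0 : (Submodule.Quotient.mk y : W ⧸ p) = 0 := (Submodule.Quotient.mk_eq_zero p).2 hy
  have : (Submodule.Quotient.mk w : W ⧸ p)
      - (t (Submodule.Quotient.mk w') - c • Submodule.Quotient.mk w')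
      = Submodule.Quotient.mk (w - (A w' - c • w') - y) := by
    simp only [Submodule.Quotient.mk_sub, Submodule.Quotient.mk_smul, h0, sub_zero]
    rfl
  rw [this]
  exact Submodule.Quotient.norm_mk_le p _

/-- If a bounded family of functionals is controlled by a quadratic form `E` up to `δ`, then
every element of the unit ball of the bidual is within `2δ` of the unit ball of `X`, uniformly on
the family. -/
theorem exists_uniform_approx_bidual {X : Type*} [NormedAddCommGroup X] [NormedSpace ℂ X]
    (C : Set (StrongDual ℂ X)) {δ : ℝ} (E : X → ℝ)
    (hEpar : ∀ x y, E (x + y) + E (x - y) = 2 * E x + 2 * E y)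
    (hE0 : ∀ x, 0 ≤ E x) {B : ℝ} (hEB : ∀ x, ‖x‖ ≤ 1 → E x ≤ B)
    (hEC : ∀ x, ‖x‖ ≤ 1 → E x ≤ 1 → ∀ φ ∈ C, ‖φ x‖ ≤ δ)
    (z : StrongDual ℂ (StrongDual ℂ X)) (hz : ‖z‖ ≤ 1) :
    ∃ x : X, ‖x‖ ≤ 1 ∧ ∀ φ ∈ C, ‖z φ - φ x‖ ≤ 2 * δ := by
  classical
  let U : Finset (StrongDual ℂ X) → ℝ → Set X :=
    fun F η => {x | ‖x‖ ≤ 1 ∧ ∀ φ ∈ F, ‖φ x - z φ‖ < η}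
  have hU : ∀ F η, 0 < η → (U F η).Nonempty := fun F η hη =>
    exists_norm_le_one_forall_finset_norm_sub_lt z hz F hη
  let R : Set ℝ := {r | ∃ F, ∃ η > 0, ∀ x ∈ U F η, r ≤ E x}
  have hR0 : R.Nonempty := ⟨0, ∅, 1, one_pos, fun x _ => hE0 x⟩
  have hRB : BddAbove R := by
    refine ⟨B, ?_⟩
    rintro r ⟨F, η, hη, h⟩
    obtain ⟨x, hx⟩ := hU F η hη
    exact (h x hx).trans (hEB x hx.1)
  obtain ⟨r, ⟨F, η, hη, hr⟩, hrs⟩ :=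
    exists_lt_of_lt_csSup hR0 (sub_lt_self (sSup R) (by norm_num : (0 : ℝ) < 1 / 2))
  have key : ∀ F' η', 0 < η' → ∃ x ∈ U F' η', E x < sSup R + 1 / 2 := fun F' η' hη' => by
    by_contra! h
    have := le_csSup hRB ⟨F', η', hη', h⟩
    linarith
  obtain ⟨x, hx, hxs⟩ := key F η hη
  refine ⟨x, hx.1, fun φ hφ => le_of_forall_pos_le_add fun η' hη' => ?_⟩
  obtain ⟨x', hx', hxs'⟩ := key (insert φ F) (min η η') (lt_min hη hη')
  set u := (2⁻¹ : ℂ) • (x + x') with hu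
  set v := (2⁻¹ : ℂ) • (x - x') with hv
  have huv : u + v = x := by
    rw [hu, hv, ← smul_add, add_add_sub_cancel, ← two_smul ℂ x, smul_smul]
    norm_num
  have huv' : u - v = x' := by
    rw [hu, hv, ← smul_sub, add_sub_sub_cancel, ← two_smul ℂ x', smul_smul]; norm_num
  have hpar := hEpar u v
  rw [huv, huv'] at hpar
  have huU : u ∈ U F η := by
    refine ⟨?_, fun ψ hψ => ?_⟩
    · rw [hu, norm_smul]
      have := norm_add_le x x'
      have := hx.1
      have := hx'.1
      norm_num
      linarith
    · have h1 := hx.2 ψ hψ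
      have h2 := (hx'.2 ψ (Finset.mem_insert_of_mem hψ)).trans_le (min_le_left _ _)
      have e : ψ u - z ψ = 2⁻¹ * ((ψ x - z ψ) + (ψ x' - z ψ)) := by
        rw [hu, map_smul, map_add, smul_eq_mul]; ring
      rw [e, norm_mul]
      have := norm_add_le (ψ x - z ψ) (ψ x' - z ψ)
      norm_num
      linarith
  have hv1 : ‖v‖ ≤ 1 := by
    rw [hv, norm_smul]
    have := norm_sub_le x x'
    have := hx.1
    have := hx'.1
    norm_num
    linarith
  have hEv : E v ≤ 1 := by
    have := hr u huU
    linarith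
  have h1 := hEC v hv1 hEv φ hφ
  have h2 := (hx'.2 φ (Finset.mem_insert_self _ _)).trans_le (min_le_right _ _)
  have e : z φ - φ x = -(φ x' - z φ) - 2 * φ v := by
    rw [hv, map_smul, map_sub, smul_eq_mul]; ring
  rw [e]
  refine (norm_sub_le _ _).trans ?_
  rw [norm_neg, norm_mul]
  norm_num
  linarith

/-- Every decreasing pointwise null sequence of sets of functionals eventually consists of
functionals that are small on the unit ball of some bounded quadratic form. -/
def HasQuadraticControl (X : Type*) [NormedAddCommGroup X] [NormedSpace ℂ X] : Prop :=
  ∀ C : ℕ → Set (StrongDual ℂ X), Antitone C → (∀ k, ∀ φ ∈ C k, ‖φ‖ ≤ 1) →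
    (∀ x, ∀ ε > 0, ∃ k, ∀ φ ∈ C k, ‖φ x‖ ≤ ε) → ∀ δ > 0, ∃ k, ∃ E : X → ℝ,
      (∀ x y, E (x + y) + E (x - y) = 2 * E x + 2 * E y) ∧ (∀ x, 0 ≤ E x) ∧
      (∃ B, ∀ x, ‖x‖ ≤ 1 → E x ≤ B) ∧ ∀ x, ‖x‖ ≤ 1 → E x ≤ 1 → ∀ φ ∈ C k, ‖φ x‖ ≤ δ

theorem exists_dual_eq_zero_on_ne_zero {X : Type*} [NormedAddCommGroup X] [NormedSpace ℂ X]
    (p : Submodule ℂ X) (hp : IsClosed (p : Set X)) {x : X} (hx : x ∉ p) :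
    ∃ φ : StrongDual ℂ X, (∀ y ∈ p, φ y = 0) ∧ φ x ≠ 0 := by
  have : IsClosed (p : Set X) := hp
  have hx' : (Submodule.Quotient.mk x : X ⧸ p) ≠ 0 := by
    rwa [Ne, Submodule.Quotient.mk_eq_zero]
  obtain ⟨g, hg⟩ := SeparatingDual.exists_ne_zero (R := ℂ) hx'
  refine ⟨g.comp p.mkQL, fun y hy => ?_, hg⟩
  have : (Submodule.Quotient.mk y : X ⧸ p) = 0 := by rwa [Submodule.Quotient.mk_eq_zero]
  change g (Submodule.Quotient.mk y) = 0
  rw [this, map_zero]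

/-- Given a proper closed invariant subspace `p` of the dual of `Y` for the adjoint of `A`, some
functional is uniformly far from `p` on the approximate eigenvectors of `A` for some scalar. -/
theorem exists_far_on_approx_eigenvectors {Y : Type*} [NormedAddCommGroup Y] [NormedSpace ℂ Y]
    (A : Y →L[ℂ] Y) (p : Submodule ℂ (StrongDual ℂ Y)) (hp : IsClosed (p : Set (StrongDual ℂ Y)))
    (hp' : p ≠ ⊤) (hA : ∀ w ∈ p, w.comp A ∈ p) :
    ∃ c : ℂ, ∀ r > 0, ∃ z : StrongDual ℂ Y, ‖z‖ ≤ 1 ∧ ∀ y ∈ p,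
      ∃ φ : Y, ‖φ‖ ≤ 1 ∧ ‖A φ - c • φ‖ ≤ r ∧ 1 / 4 < ‖z φ - y φ‖ := by
  obtain ⟨c, hc⟩ :=
    exists_not_almost_open_sub_smul_mod p hp hp' (ContinuousLinearMap.precomp ℂ A) hA
  refine ⟨c, fun r hr => ?_⟩
  obtain ⟨w, hw, hw'⟩ := hc (2 * (r⁻¹ * (1 / 4)))
  refine ⟨(2⁻¹ : ℂ) • w, by rw [norm_smul]; norm_num; linarith, fun x hx => ?_⟩
  by_contra! hxC
  obtain ⟨z, y, hz, hy, hzy⟩ := exists_eq_add_comp_of_norm_le (A - c • ContinuousLinearMap.id ℂ Y)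
    ((2⁻¹ : ℂ) • w - x) hr (by norm_num : (0 : ℝ) ≤ 1 / 4) hxC
  have h2 : ‖(2 : ℂ) • z‖ ≤ 1 / 2 := by rw [norm_smul]; norm_num; linarith
  refine (hw' ((2 : ℂ) • y) ?_ ((2 : ℂ) • x) (p.smul_mem _ hx)).not_ge
    (le_of_eq_of_le (congrArg norm ?_) h2)
  · rw [norm_smul, Complex.norm_ofNat]
    gcongr
  · ext φ
    have h := hzy φ
    have e : y ((A - c • ContinuousLinearMap.id ℂ Y) φ) = y (A φ) - c * y φ := by
      change y (A φ - c • φ) = _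
      rw [map_sub, map_smul, smul_eq_mul]
    change (2⁻¹ : ℂ) * w φ - x φ = z φ + y ((A - c • ContinuousLinearMap.id ℂ Y) φ) at h
    rw [e] at h
    change w φ - (2 * y (A φ) - c * (2 * y φ)) - 2 * x φ = 2 * z φ
    linear_combination 2 * h

/-- On a nonreflexive space with quadratic control, some scalar translate of every operator fails
to have dense range. -/
theorem HasQuadraticControl.exists_not_denseRange_sub_smul {X : Type*} [NormedAddCommGroup X]
    [NormedSpace ℂ X] [CompleteSpace X] (hX : HasQuadraticControl X)
    (hJ : ¬ Function.Surjective (inclusionInDoubleDual ℂ X)) (T : X →L[ℂ] X) :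
    ∃ c : ℂ, ¬ DenseRange fun x => T x - c • x := by
  let p : Submodule ℂ (StrongDual ℂ (StrongDual ℂ X)) :=
    LinearMap.range (inclusionInDoubleDual ℂ X).toLinearMap
  have hpc : IsClosed (p : Set (StrongDual ℂ (StrongDual ℂ X))) :=
    (LinearIsometry.isometry (inclusionInDoubleDualLi (E := X)
      ℂ)).isUniformInducing.isComplete_range.isClosed
  have hinv : ∀ w ∈ p, w.comp (ContinuousLinearMap.precomp ℂ T) ∈ p := by
    rintro _ ⟨x, rfl⟩
    exact ⟨T x, rfl⟩
  obtain ⟨c, hc⟩ := exists_far_on_approx_eigenvectors (ContinuousLinearMap.precomp ℂ T) p hpc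
    (fun h => hJ (LinearMap.range_eq_top.1 h)) hinv
  refine ⟨c, fun hd => ?_⟩
  let S : X →L[ℂ] X := T - c • ContinuousLinearMap.id ℂ X
  have hS : DenseRange S := hd
  let C : ℕ → Set (StrongDual ℂ X) := fun k => {φ | ‖φ‖ ≤ 1 ∧ ‖φ.comp S‖ ≤ 1 / (k + 1 : ℝ)}
  obtain ⟨k, E, hE1, hE0, ⟨B, hEB⟩, hEC⟩ := hX C
    (fun a b hab φ hφ => ⟨hφ.1, hφ.2.trans (by gcongr)⟩) (fun k φ hφ => hφ.1)
    (fun x ε hε => by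
      obtain ⟨y, hy⟩ := hS.exists_dist_lt x (half_pos hε)
      obtain ⟨k, hk⟩ := exists_nat_gt (2 * ‖y‖ / ε)
      refine ⟨k, fun φ hφ => ?_⟩
      have h1 : ‖φ (x - S y)‖ ≤ ε / 2 := calc
        _ ≤ ‖φ‖ * ‖x - S y‖ := φ.le_opNorm _
        _ ≤ 1 * (ε / 2) := by
          rw [dist_eq_norm] at hy
          exact mul_le_mul hφ.1 hy.le (norm_nonneg _) zero_le_one
        _ = ε / 2 := one_mul _
      have h2 : ‖φ (S y)‖ ≤ ε / 2 := calc
        _ ≤ ‖φ.comp S‖ * ‖y‖ := (φ.comp S).le_opNorm _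
        _ ≤ 1 / (k + 1) * ‖y‖ := by gcongr; exact hφ.2
        _ ≤ ε / 2 := by
          rw [div_lt_iff₀ hε] at hk
          rw [one_div, inv_mul_le_iff₀ (by positivity)]
          linarith
      have : φ x = φ (x - S y) + φ (S y) := by rw [map_sub, sub_add_cancel]
      rw [this]
      exact (norm_add_le _ _).trans (by linarith))
    (1 / 8) (by norm_num)
  set r : ℝ := 1 / (k + 1)
  have hr : 0 < r := by positivity
  obtain ⟨z, hz, hz'⟩ := hc r hr
  obtain ⟨x, hx, hxC⟩ := exists_uniform_approx_bidual (C k) E hE1 hE0 hEB hEC z hz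
  obtain ⟨φ, hφ, hφr, hlt⟩ := hz' (inclusionInDoubleDual ℂ X x) ⟨x, rfl⟩
  have hφS : φ.comp S = φ.comp T - c • φ := by
    ext v
    simp [S]
  have h := hxC φ ⟨hφ, (congrArg norm hφS).trans_le hφr⟩
  rw [dual_def] at hlt
  linarith

theorem TopologicallyTransitive.denseRange_sub_smul {X : Type*} [NormedAddCommGroup X]
    [NormedSpace ℂ X] {T : X →L[ℂ] X} (hT : TopologicallyTransitive T) (c : ℂ) :
    DenseRange fun x => T x - c • x := by
  by_contra hd
  let S : X →L[ℂ] X := T - c • ContinuousLinearMap.id ℂ X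
  let p : Submodule ℂ X := (LinearMap.range S.toLinearMap).topologicalClosure
  obtain ⟨x₀, hx₀⟩ : ∃ x, x ∉ p := by
    by_contra! h
    exact hd h
  obtain ⟨φ, hφ, hφx⟩ := exists_dual_eq_zero_on_ne_zero p
    (Submodule.isClosed_topologicalClosure _) hx₀
  have hφT : ∀ x, φ (T x) = c * φ x := fun x => by
    have h : φ (S x) = 0 := hφ _ (Submodule.le_topologicalClosure _ ⟨x, rfl⟩)
    have e : S x = T x - c • x := rfl
    rw [e, map_sub, map_smul, smul_eq_mul, sub_eq_zero] at h
    exact h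
  have hφn : ∀ n x, φ ((T ^ n) x) = c ^ n * φ x := fun n x => by
    induction n with
    | zero => simp
    | succ n ih =>
      rw [pow_succ', mul_apply_eq_comp, hφT, ih]
      ring
  have hsurj : ∀ a : ℂ, ∃ x, φ x = a := fun a =>
    ⟨(a / φ x₀) • x₀, by rw [map_smul, smul_eq_mul, div_mul_cancel₀ _ hφx]⟩
  have hlt : ∀ r, IsOpen {x | ‖φ x‖ < r} := fun r => isOpen_lt (by fun_prop) continuous_const
  have hgt : ∀ r, IsOpen {x | r < ‖φ x‖} := fun r => isOpen_lt continuous_const (by fun_prop)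
  obtain ⟨x₂, hx₂⟩ := hsurj 2
  have h₂ : 1 < ‖φ x₂‖ := by rw [hx₂]; norm_num
  rcases le_or_gt ‖c‖ 1 with hc | hc
  · obtain ⟨n, -, _, ⟨x, hx, rfl⟩, hy⟩ := hT {x | ‖φ x‖ < 1} {x | 1 < ‖φ x‖} (hlt 1) (hgt 1)
      ⟨0, by simp⟩ ⟨x₂, h₂⟩
    rw [Set.mem_ofPred_eq, hφn, norm_mul, norm_pow] at hy
    have := mul_le_of_le_one_left (norm_nonneg (φ x)) (pow_le_one₀ (n := n) (norm_nonneg c) hc)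
    exact absurd hx (by rw [Set.mem_ofPred_eq]; linarith)
  · obtain ⟨n, -, _, ⟨x, hx, rfl⟩, hy⟩ := hT {x | 1 < ‖φ x‖} {x | ‖φ x‖ < 1} (hgt 1) (hlt 1)
      ⟨x₂, h₂⟩ ⟨0, by simp⟩
    rw [Set.mem_ofPred_eq, hφn, norm_mul, norm_pow] at hy
    have := le_mul_of_one_le_left (norm_nonneg (φ x)) (one_le_pow₀ (n := n) hc.le)
    exact absurd hx (by rw [Set.mem_ofPred_eq]; linarith)

theorem exists_hyperfilter_weakStar_limit {Y : Type*} [NormedAddCommGroup Y] [NormedSpace ℂ Y]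
    (y : ℕ → StrongDual ℂ Y) (hy : ∀ n, ‖y n‖ ≤ 1) :
    ∃ z : StrongDual ℂ Y, ∀ φ, Tendsto (fun n => y n φ) (hyperfilter ℕ) (𝓝 (z φ)) := by
  have hK := WeakDual.isCompact_closedBall (𝕜 := ℂ) (0 : StrongDual ℂ Y) 1
  obtain ⟨z, -, hz⟩ := isCompact_iff_ultrafilter_le_nhds.1 hK
    ((hyperfilter ℕ).map fun n => StrongDual.toWeakDual (y n)) (by
      rw [le_principal_iff, Ultrafilter.mem_coe, Ultrafilter.mem_map]
      exact Filter.univ_mem' fun n => by simpa using hy n)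
  exact ⟨WeakDual.toStrongDual z, fun φ => ((WeakDual.eval_continuous φ).tendsto z).comp hz⟩

theorem exists_hyperfilter_weak_limit {X : Type*} [NormedAddCommGroup X] [NormedSpace ℂ X]
    (hJ : Function.Surjective (inclusionInDoubleDual ℂ X)) (y : ℕ → X) (hy : ∀ n, ‖y n‖ ≤ 1) :
    ∃ x : X, ∀ φ : StrongDual ℂ X, Tendsto (fun n => φ (y n)) (hyperfilter ℕ) (𝓝 (φ x)) := by
  obtain ⟨z, hz⟩ := exists_hyperfilter_weakStar_limit
    (fun n => inclusionInDoubleDual ℂ X (y n))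
    (fun n => (double_dual_bound ℂ _ (y n)).trans (hy n))
  obtain ⟨x, rfl⟩ := hJ z
  exact ⟨x, hz⟩

section Hilbert
variable {H : Type*} [NormedAddCommGroup H] [InnerProductSpace ℂ H]

theorem not_surjective_inclusionInDoubleDual_of_orthonormal (e : ℕ → H) (he : Orthonormal ℂ e) :
    ¬ Function.Surjective (inclusionInDoubleDual ℂ (H →L[ℂ] H)) := by
  intro hJ
  let W : ℕ → Submodule ℂ H := fun n => Submodule.span ℂ (e '' Set.Iio n)
  have hW : ∀ n, FiniteDimensional ℂ (W n) := fun n =>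
    FiniteDimensional.span_of_finite ℂ ((Set.finite_Iio n).image e)
  let P : ℕ → H →L[ℂ] H := fun n => (W n).starProjection
  have hP1 : ∀ n i, i < n → P n (e i) = e i := fun n i hi =>
    Submodule.starProjection_eq_self_iff.2 (Submodule.subset_span ⟨i, hi, rfl⟩)
  have hP0 : ∀ n i, n ≤ i → P n (e i) = 0 := fun n i hi => by
    refine (Submodule.starProjection_apply_eq_zero_iff _).2 ?_
    rw [Submodule.mem_orthogonal]
    intro u hu
    refine Submodule.span_induction ?_ (by simp)
      (fun _ _ _ _ h1 h2 => by simp [inner_add_left, h1, h2])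
      (fun _ _ _ h => by simp [inner_smul_left, h]) hu
    rintro _ ⟨j, hj, rfl⟩
    exact he.2 (ne_of_lt (lt_of_lt_of_le hj hi))
  obtain ⟨x, hx⟩ := exists_hyperfilter_weak_limit hJ P fun n => Submodule.starProjection_norm_le _
  have hxi : ∀ i, inner ℂ (e i) (x (e i)) = 1 := fun i => by
    refine tendsto_nhds_unique (hx ((innerSL ℂ (e i)).comp (ContinuousLinearMap.apply ℂ H (e i))))
      (tendsto_const_nhds.congr' ?_)
    have : ∀ᶠ n in hyperfilter ℕ, i < n :=
      Nat.hyperfilter_le_atTop (eventually_gt_atTop i)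
    filter_upwards [this] with n hn
    simp [hP1 n i hn, he.1 i]
  let p : Submodule ℂ (H →L[ℂ] H) := (Submodule.span ℂ (Set.range P)).topologicalClosure
  have hxp : x ∈ p := by
    by_contra hxp
    obtain ⟨φ, hφ, hφx⟩ := exists_dual_eq_zero_on_ne_zero p
      (Submodule.isClosed_topologicalClosure _) hxp
    refine hφx (tendsto_nhds_unique (hx φ) (tendsto_const_nhds.congr fun n => ?_))
    exact (hφ _ (Submodule.le_topologicalClosure _ (Submodule.subset_span ⟨n, rfl⟩))).symm
  obtain ⟨y, hy, hxy⟩ := Metric.mem_closure_iff.1 hxp 1 one_pos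
  obtain ⟨N, hN⟩ : ∃ N, ∀ i ≥ N, y (e i) = 0 := by
    refine Submodule.span_induction ?_ ⟨0, by simp⟩ ?_ ?_ hy
    · rintro _ ⟨n, rfl⟩
      exact ⟨n, hP0 n⟩
    · rintro a b - - ⟨N, hN⟩ ⟨M, hM⟩
      exact ⟨max N M, fun i hi => by
        simp [hN i ((le_max_left _ _).trans hi), hM i ((le_max_right _ _).trans hi)]⟩
    · rintro c a - ⟨N, hN⟩
      exact ⟨N, fun i hi => by simp [hN i hi]⟩
  have h1 : inner ℂ (e N) ((x - y) (e N)) = 1 := by simp [hN N le_rfl, hxi]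
  have h2 := (norm_inner_le_norm (𝕜 := ℂ) (e N) ((x - y) (e N))).trans
    (mul_le_mul_of_nonneg_left ((x - y).le_opNorm (e N)) (norm_nonneg _))
  rw [h1, he.1 N, norm_one, one_mul, mul_one, ← dist_eq_norm] at h2
  linarith

end Hilbert

section CStar
variable {A : Type*} [CStarAlgebra A] [PartialOrder A] [StarOrderedRing A]

theorem star_add_mul_add_le_of_le {c c' a a' : A} {s s' : ℝ} (hs : 0 ≤ s) (hs' : 0 ≤ s')
    (ha : 0 ≤ a) (ha' : 0 ≤ a') (h : star c * c ≤ s • a) (h' : star c' * c' ≤ s' • a') :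
    star (c + c') * (c + c') ≤ (s + s') • (a + a') := by
  have e : (s + s') • (a + a') = s • a + s' • a + (s • a' + s' • a') := by
    rw [smul_add, add_smul, add_smul]
  have hz : ∀ d : A, star d * d ≤ 0 → d = 0 := fun d hd =>
    CStarRing.star_mul_self_eq_zero_iff d |>.1 (le_antisymm hd (star_mul_self_nonneg d))
  rcases hs.eq_or_lt with rfl | hs
  · rw [zero_smul] at h
    rw [hz c h, zero_add, e, zero_smul, zero_smul, zero_add, zero_add]
    exact h'.trans (le_add_of_nonneg_left (smul_nonneg hs' ha))
  rcases hs'.eq_or_lt with rfl | hs'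
  · rw [zero_smul] at h'
    rw [hz c' h', add_zero, e, zero_smul, zero_smul, add_zero, add_zero]
    exact h.trans (le_add_of_nonneg_right (smul_nonneg hs.le ha'))
  have h1 : star (s' • c - s • c') * (s' • c - s • c') =
      (s' * s') • (star c * c) - (s' * s) • (star c * c' + star c' * c)
        + (s * s) • (star c' * c') := by
    simp only [star_sub, star_smul, star_trivial, sub_mul, mul_sub, smul_mul_assoc, mul_smul_comm]
    module
  have h2 : star c * c' + star c' * c ≤ s' • a + s • a' := by
    have h3 : (s' * s) • (star c * c' + star c' * c) ≤ (s' * s) • (s' • a + s • a') := by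
      have h4 := star_mul_self_nonneg (s' • c - s • c')
      rw [h1] at h4
      have h5 : (s' * s) • (star c * c' + star c' * c) ≤
          (s' * s') • (star c * c) + (s * s) • (star c' * c') := by
        rw [← sub_nonneg]
        convert h4 using 1
        abel
      refine h5.trans ((add_le_add (smul_le_smul_of_nonneg_left h (by positivity))
        (smul_le_smul_of_nonneg_left h' (by positivity))).trans_eq ?_)
      simp only [smul_add, smul_smul]
      congr 2 <;> ring
    have := smul_le_smul_of_nonneg_left h3 (inv_nonneg.2 (mul_pos hs' hs).le)
    rwa [inv_smul_smul₀ (mul_pos hs' hs).ne', inv_smul_smul₀ (mul_pos hs' hs).ne'] at this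
  calc star (c + c') * (c + c')
      = star c * c + (star c * c' + star c' * c) + star c' * c' := by
        rw [star_add, add_mul, mul_add, mul_add]; abel
    _ ≤ s • a + (s' • a + s • a') + s' • a' := by gcongr
    _ = (s + s') • (a + a') := by rw [e]; abel

/-- Sums of `(x⋆x, ρ(x)²)` over a contractive real functional `ρ` satisfy `s ≤ ‖a‖`. -/
theorem le_norm_of_mem_span_square (ρ : A →L[ℝ] ℝ) (hρ : ‖ρ‖ ≤ 1) {q : A × ℝ}
    (hq : q ∈ Submodule.span NNReal (Set.range fun x : A => (star x * x, ρ x ^ 2))) :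
    q.2 ≤ ‖q.1‖ := by
  have key : 0 ≤ q.2 ∧ 0 ≤ q.1 ∧ ∃ c, ρ c = q.2 ∧ star c * c ≤ q.2 • q.1 := by
    refine Submodule.span_induction ?_ ?_ ?_ ?_ hq
    · rintro _ ⟨x, rfl⟩
      refine ⟨sq_nonneg _, star_mul_self_nonneg x, ρ x • x, ?_, ?_⟩
      · rw [map_smul, smul_eq_mul, ← sq]
      · simp only [star_smul, star_trivial, smul_mul_assoc, mul_smul_comm, smul_smul, sq, le_refl]
    · exact ⟨le_rfl, le_rfl, 0, by simp⟩
    · rintro p q - - ⟨hs, ha, c, hc, h⟩ ⟨hs', ha', c', hc', h'⟩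
      exact ⟨add_nonneg hs hs', add_nonneg ha ha', c + c', by rw [map_add, hc, hc']; rfl,
        star_add_mul_add_le_of_le hs hs' ha ha' h h'⟩
    · rintro t q - ⟨hs, ha, c, hc, h⟩
      have ht : 0 ≤ (t : ℝ) := t.2
      refine ⟨mul_nonneg ht hs, smul_nonneg ht ha, (t : ℝ) • c, ?_, ?_⟩
      · rw [map_smul, hc]; rfl
      · have h1 := smul_le_smul_of_nonneg_left h (mul_nonneg ht ht)
        have e1 : star ((t : ℝ) • c) * ((t : ℝ) • c) = ((t : ℝ) * t) • (star c * c) := by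
          simp only [star_smul, star_trivial, smul_mul_assoc, mul_smul_comm, smul_smul]
        have e2 : (t • q).2 • (t • q).1 = ((t : ℝ) * t) • (q.2 • q.1) := by
          change ((t : ℝ) * q.2) • ((t : ℝ) • q.1) = _
          rw [smul_smul, smul_smul]
          congr 1
          ring
        rwa [e1, e2]
  obtain ⟨hs, ha, c, hc, h⟩ := key
  rcases hs.eq_or_lt with h0 | hs
  · rw [← h0]; exact norm_nonneg _
  have h1 : q.2 ≤ ‖c‖ := by
    rw [← hc]
    exact (le_abs_self _).trans ((ρ.le_opNorm c).trans
      ((mul_le_mul_of_nonneg_right hρ (norm_nonneg c)).trans_eq (one_mul _)))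
  have h2 : ‖c‖ * ‖c‖ ≤ q.2 * ‖q.1‖ := by
    rw [← CStarRing.norm_star_mul_self]
    refine (CStarAlgebra.norm_le_norm_of_nonneg_of_le (star_mul_self_nonneg c) h).trans_eq ?_
    rw [norm_smul, Real.norm_of_nonneg hs.le]
  have h3 : q.2 * q.2 ≤ ‖c‖ * ‖c‖ := by gcongr
  exact le_of_mul_le_mul_left (h3.trans h2) hs

/-- A contractive real functional on a C⋆-algebra is dominated by a positive one. -/
theorem exists_positive_majorant_real (ρ : A →L[ℝ] ℝ) (hρ : ‖ρ‖ ≤ 1) :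
    ∃ ψ : A →L[ℝ] ℝ, (∀ a, 0 ≤ a → 0 ≤ ψ a) ∧ (∀ a, ψ a ≤ ‖a‖) ∧
      ∀ x, ρ x ^ 2 ≤ ψ (star x * x) := by
  let K : Submodule NNReal (A × ℝ) :=
    Submodule.span NNReal (Set.range fun x : A => (star x * x, ρ x ^ 2))
  have hKconv : Convex ℝ (K : Set (A × ℝ)) := by
    intro x hx y hy a b ha hb _
    exact K.add_mem (K.smul_mem ⟨a, ha⟩ hx) (K.smul_mem ⟨b, hb⟩ hy)
  let O : Set (A × ℝ) := {q | ‖q.1‖ < q.2}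
  have hO : IsOpen O := isOpen_lt (by fun_prop) (by fun_prop)
  have hOconv : Convex ℝ O := by
    intro x hx y hy a b ha hb hab
    have h1 : ‖(a • x + b • y).1‖ ≤ a * ‖x.1‖ + b * ‖y.1‖ := by
      refine (norm_add_le _ _).trans_eq ?_
      rw [Prod.smul_fst, Prod.smul_fst, norm_smul, norm_smul, Real.norm_of_nonneg ha,
        Real.norm_of_nonneg hb]
    refine h1.trans_lt ?_
    change a * ‖x.1‖ + b * ‖y.1‖ < a * x.2 + b * y.2
    have hx' : ‖x.1‖ < x.2 := hx
    have hy' : ‖y.1‖ < y.2 := hy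
    rcases ha.eq_or_lt with rfl | ha
    · rw [zero_add] at hab
      simpa [hab] using hy'
    · exact add_lt_add_of_lt_of_le (by gcongr) (by gcongr)
  have hdisj : Disjoint O K := by
    rw [Set.disjoint_left]
    intro q hq hqK
    exact (le_norm_of_mem_span_square ρ hρ hqK).not_gt hq
  obtain ⟨f, u, hfO, hfK⟩ := geometric_hahn_banach_open hOconv hO hKconv hdisj
  have hu0 : u ≤ 0 := by simpa using hfK 0 K.zero_mem
  have hK0 : ∀ q ∈ K, 0 ≤ f q := by
    intro q hq
    by_contra! hneg
    obtain ⟨n, hn⟩ := exists_nat_gt (u / f q)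
    have h1 : u ≤ f ((n : ℝ) • q) := hfK _ (K.smul_mem (n : NNReal) hq)
    rw [map_smul, smul_eq_mul] at h1
    rw [div_lt_iff_of_neg hneg] at hn
    exact h1.not_gt hn
  have hf0 : ∀ q ∈ O, f q < 0 := fun q hq => (hfO q hq).trans_le hu0
  set κ := -f (0, 1) with hκ
  have hκ0 : 0 < κ := neg_pos.2 (hf0 (0, 1) (by simp [O]))
  have hfq : ∀ a s, f (a, s) = f (a, 0) - κ * s := fun a s => by
    have : ((a, s) : A × ℝ) = (a, 0) + s • (0, 1) := by simp
    rw [this, map_add, map_smul, smul_eq_mul, hκ]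
    ring
  have hsq : ∀ x, ρ x ^ 2 ≤ κ⁻¹ * f (star x * x, 0) := fun x => by
    have h := hK0 (star x * x, ρ x ^ 2) (Submodule.subset_span ⟨x, rfl⟩)
    rw [hfq] at h
    rw [le_inv_mul_iff₀ hκ0]
    linarith
  refine ⟨κ⁻¹ • f.comp (ContinuousLinearMap.inl ℝ A ℝ), fun a ha => ?_, fun a => ?_, hsq⟩
  · obtain ⟨x, rfl⟩ := CStarAlgebra.nonneg_iff_eq_star_mul_self.1 ha
    exact (sq_nonneg _).trans (hsq x)
  · change κ⁻¹ * f (a, 0) ≤ ‖a‖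
    rw [inv_mul_le_iff₀ hκ0]
    refine le_of_forall_pos_le_add fun ε hε => ?_
    have h := hf0 (a, ‖a‖ + ε / κ) (by simp only [O, Set.mem_ofPred_eq]; linarith [div_pos hε hκ0])
    rw [hfq, mul_add, mul_div_cancel₀ _ hκ0.ne'] at h
    linarith

/-- `ψ` is a bounded positive functional with `|φ(x)|² ≤ ψ(x⋆x)` and `|φ(x)|² ≤ ψ(xx⋆)`. -/
structure IsPositiveMajorant (φ : StrongDual ℂ A) (ψ : A →L[ℝ] ℝ) : Prop where
  nonneg : ∀ a, 0 ≤ a → 0 ≤ ψ a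
  le_two_mul_norm : ∀ a, ψ a ≤ 2 * ‖a‖
  sq_le : ∀ x, ‖φ x‖ ^ 2 ≤ ψ (star x * x) ∧ ‖φ x‖ ^ 2 ≤ ψ (x * star x)

theorem IsPositiveMajorant.mono {φ : StrongDual ℂ A} {ψ : A →L[ℝ] ℝ}
    (hψ : IsPositiveMajorant φ ψ) {a b : A} (hab : a ≤ b) : ψ a ≤ ψ b := by
  rw [← sub_nonneg, ← map_sub]
  exact hψ.nonneg _ (sub_nonneg.2 hab)

/-- A contractive functional on a C⋆-algebra is dominated by a positive one. -/
theorem exists_positive_majorant (φ : StrongDual ℂ A) (hφ : ‖φ‖ ≤ 1) :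
    ∃ ψ : A →L[ℝ] ℝ, IsPositiveMajorant φ ψ := by
  let ρ : A →L[ℝ] ℝ := Complex.reCLM.comp (φ.restrictScalars ℝ)
  let ρ' : A →L[ℝ] ℝ := ρ.comp (starL' ℝ : A ≃L[ℝ] A).toContinuousLinearMap
  have hb : ∀ x, ‖ρ x‖ ≤ ‖x‖ := fun x =>
    (Complex.abs_re_le_norm _).trans ((φ.le_opNorm x).trans
      ((mul_le_mul_of_nonneg_right hφ (norm_nonneg x)).trans_eq (one_mul _)))
  have hρ : ‖ρ‖ ≤ 1 := ContinuousLinearMap.opNorm_le_bound _ zero_le_one fun x => by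
    rw [one_mul]
    exact hb x
  have hρ' : ‖ρ'‖ ≤ 1 := ContinuousLinearMap.opNorm_le_bound _ zero_le_one fun x => by
    rw [one_mul, ← norm_star x]
    exact hb (star x)
  obtain ⟨ψ, hψ0, hψ1, hψ⟩ := exists_positive_majorant_real ρ hρ
  obtain ⟨ψ', hψ0', hψ1', hψ'⟩ := exists_positive_majorant_real ρ' hρ'
  refine ⟨ψ + ψ', fun a ha => add_nonneg (hψ0 a ha) (hψ0' a ha), fun a => ?_, fun x => ?_⟩
  · have := add_le_add (hψ1 a) (hψ1' a)
    rw [two_mul]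
    exact this
  obtain ⟨c, hc, hcx⟩ := RCLike.exists_norm_eq_mul_self (φ x)
  have hcc : star c * c = 1 := by
    have : (star c * c : ℂ) = ((‖c‖ ^ 2 : ℝ) : ℂ) := by
      rw [Complex.star_def, ← Complex.normSq_eq_conj_mul_self, Complex.normSq_eq_norm_sq]
    rw [this, hc]
    simp
  have hre : ρ (c • x) = ‖φ x‖ := by
    change (φ (c • x)).re = _
    rw [map_smul, smul_eq_mul, ← hcx]
    rfl
  constructor
  · have h := hψ (c • x)
    rw [hre, star_smul, smul_mul_smul_comm, hcc, one_smul] at h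
    exact h.trans (le_add_of_nonneg_right (hψ0' _ (star_mul_self_nonneg x)))
  · have h := hψ' (star (c • x))
    have e : ρ' (star (c • x)) = ‖φ x‖ := by
      change ρ (star (star (c • x))) = _
      rw [star_star, hre]
    rw [e, star_star, star_smul, smul_mul_smul_comm, mul_comm c, hcc, one_smul] at h
    exact h.trans (le_add_of_nonneg_left (hψ0 _ (mul_star_self_nonneg x)))

theorem mul_self_le_self_of_le_one {u : A} (h0 : 0 ≤ u) (h1 : u ≤ 1) : u * u ≤ u := by
  have hc : Commute u (1 - u) := (Commute.one_right u).sub_right (Commute.refl u)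
  have := hc.mul_nonneg h0 (sub_nonneg.2 h1)
  rwa [mul_sub, mul_one, sub_nonneg] at this

theorem star_mul_self_le_one_of_norm_le_one {x : A} (hx : ‖x‖ ≤ 1) : star x * x ≤ 1 := by
  rw [← CStarAlgebra.norm_le_one_iff_of_nonneg _ (star_mul_self_nonneg x),
    CStarRing.norm_star_mul_self]
  exact mul_le_one₀ hx (norm_nonneg _) hx

theorem norm_apply_mul_sq_le_of_majorant {φ : StrongDual ℂ A} {ψ : A →L[ℝ] ℝ}
    (hψ : IsPositiveMajorant φ ψ)
    {u x : A} (h0 : 0 ≤ u) (h1 : u ≤ 1) (hx : ‖x‖ ≤ 1) :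
    ‖φ (x * u)‖ ^ 2 ≤ ψ u ∧ ‖φ (u * x)‖ ^ 2 ≤ ψ u := by
  have hu : star u = u := IsSelfAdjoint.of_nonneg h0
  have key : ∀ y : A, ‖y‖ ≤ 1 → u * (star y * y) * u ≤ u := fun y hy => by
    have := star_left_conjugate_le_conjugate (star_mul_self_le_one_of_norm_le_one hy) u
    rw [hu, mul_one] at this
    exact this.trans (mul_self_le_self_of_le_one h0 h1)
  constructor
  · refine (hψ.sq_le (x * u)).1.trans (hψ.mono ?_)
    rw [star_mul, hu]
    simpa [mul_assoc] using key x hx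
  · refine (hψ.sq_le (u * x)).2.trans (hψ.mono ?_)
    rw [star_mul, hu]
    simpa [mul_assoc] using key (star x) (by rwa [norm_star])

theorem exists_truncation {d : A} (hd : 0 ≤ d) {η : ℝ} (hη : 0 < η) :
    ∃ w : A, 0 ≤ w ∧ w ≤ 1 ∧ η • w ≤ d ∧ (d - η • w) * (1 - w) = 0 ∧ (1 - w) * (d - η • w) = 0 ∧
      (∀ z, z * d = 0 → z * w = 0) ∧ ∀ z, d * z = 0 → w * z = 0 := by
  let v : ℝ → ℝ := fun t => (max t η)⁻¹
  let m : ℝ → ℝ := fun t => min (t / η) 1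
  have hv : Continuous v :=
    (continuous_id.max continuous_const).inv₀ fun t => (hη.trans_le (le_max_right _ _)).ne'
  have hm : Continuous m := by fun_prop
  have hmv : ∀ t, m t = t * v t := fun t => by
    rcases le_total t η with h | h
    · simp only [m, v, max_eq_right h]
      rw [min_eq_left ((div_le_one hη).2 h)]
      rfl
    · have ht : 0 < t := hη.trans_le h
      simp only [m, v, max_eq_left h]
      rw [min_eq_right ((one_le_div hη).2 h), mul_inv_cancel₀ ht.ne']
  have hsa : IsSelfAdjoint d := .of_nonneg hd
  have hw : cfc m d = d * cfc v d := by
    conv_rhs => enter [1]; rw [← cfc_id' ℝ d]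
    rw [← cfc_mul _ _ d (by fun_prop) hv.continuousOn]
    exact cfc_congr fun t _ => hmv t
  have hw' : cfc m d = cfc v d * d := by
    conv_rhs => enter [2]; rw [← cfc_id' ℝ d]
    rw [← cfc_mul _ _ d hv.continuousOn (by fun_prop)]
    exact cfc_congr fun t _ => (hmv t).trans (mul_comm _ _)
  have h1 : d - η • cfc m d = cfc (fun t => t - η * m t) d := by
    rw [cfc_sub _ _ d (by fun_prop) (by fun_prop), cfc_id' ℝ d, cfc_const_mul _ _ d (by fun_prop)]
  have h2 : 1 - cfc m d = cfc (fun t => 1 - m t) d := by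
    rw [cfc_sub _ _ d (by fun_prop) (by fun_prop), cfc_const_one ℝ d]
  have h0 : ∀ t, (t - η * m t) * (1 - m t) = 0 := fun t => by
    rcases le_total t η with h | h
    · simp only [m]
      rw [min_eq_left ((div_le_one hη).2 h), mul_div_cancel₀ _ hη.ne', sub_self, zero_mul]
    · simp only [m]
      rw [min_eq_right ((one_le_div hη).2 h), sub_self, mul_zero]
  have hspec : ∀ t ∈ spectrum ℝ d, 0 ≤ t := fun t ht => spectrum_nonneg_of_nonneg hd ht
  refine ⟨cfc m d, cfc_nonneg fun t ht => ?_, cfc_le_one _ _ fun t ht => min_le_right _ _, ?_, ?_,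
    ?_, fun z hz => ?_, fun z hz => ?_⟩
  · exact le_min (div_nonneg (hspec t ht) hη.le) zero_le_one
  · rw [← sub_nonneg, h1]
    refine cfc_nonneg fun t ht => ?_
    have : η * m t ≤ η * (t / η) := by gcongr; exact min_le_left _ _
    rw [mul_div_cancel₀ _ hη.ne'] at this
    linarith
  · rw [h1, h2, ← cfc_mul _ _ d (by fun_prop) (by fun_prop)]
    simp only [h0]
    exact cfc_const_zero ℝ d
  · rw [h1, h2, ← cfc_mul _ _ d (by fun_prop) (by fun_prop)]
    simp only [mul_comm (1 - m _), h0]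
    exact cfc_const_zero ℝ d
  · rw [hw, ← mul_assoc, hz, zero_mul]
  · rw [hw', mul_assoc, hz, mul_zero]

/-- The resolvent `(1 + h)⁻¹`. -/
noncomputable def resolventOneAdd (h : A) : A := Ring.inverse (1 + h)

section resolvent
variable {h h' : A}

theorem isUnit_one_add_of_nonneg (hh : 0 ≤ h) : IsUnit (1 + h) :=
  CStarAlgebra.isUnit_of_le 1 (le_add_of_nonneg_right hh)

theorem mul_resolventOneAdd (hh : 0 ≤ h) : h * resolventOneAdd h = 1 - resolventOneAdd h := by
  have := Ring.mul_inverse_cancel _ (isUnit_one_add_of_nonneg hh)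
  rw [add_mul, one_mul] at this
  exact eq_sub_of_add_eq' this

theorem resolventOneAdd_mul (hh : 0 ≤ h) : resolventOneAdd h * h = 1 - resolventOneAdd h := by
  have := Ring.inverse_mul_cancel _ (isUnit_one_add_of_nonneg hh)
  rw [mul_add, mul_one] at this
  exact eq_sub_of_add_eq' this

theorem resolventOneAdd_zero {B : Type*} [CStarAlgebra B] : resolventOneAdd (0 : B) = 1 := by
  simp [resolventOneAdd]

theorem resolventOneAdd_anti (hh : 0 ≤ h) (hle : h ≤ h') :
    resolventOneAdd h' ≤ resolventOneAdd h := by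
  obtain ⟨u, hu⟩ := isUnit_one_add_of_nonneg hh
  obtain ⟨v, hv⟩ := isUnit_one_add_of_nonneg (hh.trans hle)
  rw [resolventOneAdd, resolventOneAdd, ← hu, ← hv, Ring.inverse_unit, Ring.inverse_unit]
  refine CStarAlgebra.inv_le_inv ?_ ?_
  · rw [hu]; exact add_nonneg zero_le_one hh
  · rw [hu, hv]; gcongr

theorem resolventOneAdd_le_one (hh : 0 ≤ h) : resolventOneAdd h ≤ 1 :=
  (resolventOneAdd_anti le_rfl hh).trans_eq resolventOneAdd_zero

theorem resolventOneAdd_nonneg (hh : 0 ≤ h) : 0 ≤ resolventOneAdd h := by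
  obtain ⟨u, hu⟩ := isUnit_one_add_of_nonneg hh
  rw [resolventOneAdd, ← hu, Ring.inverse_unit]
  refine CFC.inv_nonneg_of_nonneg u ?_
  rw [hu]
  exact add_nonneg zero_le_one hh

theorem one_sub_resolventOneAdd_le (hh : 0 ≤ h) : 1 - resolventOneAdd h ≤ h := by
  have h1 := star_left_conjugate_nonneg (resolventOneAdd_nonneg hh) h
  rw [(IsSelfAdjoint.of_nonneg hh).star_eq, mul_resolventOneAdd hh, sub_mul, one_mul,
    resolventOneAdd_mul hh] at h1
  exact sub_nonneg.1 h1

theorem resolventOneAdd_conjugate_le_one (hh : 0 ≤ h) :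
    resolventOneAdd h * h * resolventOneAdd h ≤ 1 := by
  rw [resolventOneAdd_mul hh, sub_mul, one_mul]
  refine (sub_le_self _ ?_).trans (resolventOneAdd_le_one hh)
  have := star_mul_self_nonneg (resolventOneAdd h)
  rwa [(IsSelfAdjoint.of_nonneg (resolventOneAdd_nonneg hh)).star_eq] at this

theorem mul_resolventOneAdd_of_mul_eq_zero (hh : 0 ≤ h) {z : A} (hz : z * h = 0) :
    z * resolventOneAdd h = z := by
  have := congrArg (z * ·) (mul_resolventOneAdd hh)
  simp only [← mul_assoc, hz, zero_mul, mul_sub, mul_one] at this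
  exact (sub_eq_zero.1 this.symm).symm

theorem resolventOneAdd_mul_of_mul_eq_zero (hh : 0 ≤ h) {z : A} (hz : h * z = 0) :
    resolventOneAdd h * z = z := by
  have := congrArg (· * z) (resolventOneAdd_mul hh)
  simp only [mul_assoc, hz, mul_zero, sub_mul, one_mul] at this
  exact (sub_eq_zero.1 this.symm).symm

/-- If `x x⋆ ≤ η² h` then `(1 + h)⁻¹ x` has norm at most `η`. -/
theorem norm_resolventOneAdd_mul_le (hh : 0 ≤ h) {x : A} {η : ℝ} (hη : 0 ≤ η)
    (hx : x * star x ≤ η ^ 2 • h) : ‖resolventOneAdd h * x‖ ≤ η := by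
  have hg := resolventOneAdd_nonneg hh
  have hs := (IsSelfAdjoint.of_nonneg hg).star_eq
  rw [← sq_le_sq₀ (norm_nonneg _) hη, sq, ← CStarRing.norm_self_mul_star, star_mul, hs]
  have h1 : resolventOneAdd h * x * (star x * resolventOneAdd h) ≤ η ^ 2 • (1 : A) := by
    have h2 := star_left_conjugate_le_conjugate hx (resolventOneAdd h)
    rw [hs, mul_smul_comm, smul_mul_assoc] at h2
    rw [show resolventOneAdd h * x * (star x * resolventOneAdd h)
      = resolventOneAdd h * (x * star x) * resolventOneAdd h by simp only [mul_assoc]]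
    exact h2.trans (smul_le_smul_of_nonneg_left (resolventOneAdd_conjugate_le_one hh) (sq_nonneg η))
  have h0 : 0 ≤ resolventOneAdd h * x * (star x * resolventOneAdd h) := by
    have := mul_star_self_nonneg (resolventOneAdd h * x)
    rwa [star_mul, hs] at this
  refine (CStarAlgebra.norm_le_norm_of_nonneg_of_le h0 h1).trans ?_
  rw [norm_smul, Real.norm_of_nonneg (sq_nonneg η)]
  refine mul_le_of_le_one_right (sq_nonneg η) ?_
  rcases subsingleton_or_nontrivial A with hA | hA
  · simp [Subsingleton.elim (1 : A) 0]
  · simp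

theorem norm_mul_resolventOneAdd_le (hh : 0 ≤ h) {x : A} {η : ℝ} (hη : 0 ≤ η)
    (hx : star x * x ≤ η ^ 2 • h) : ‖x * resolventOneAdd h‖ ≤ η := by
  have hs := (IsSelfAdjoint.of_nonneg (resolventOneAdd_nonneg hh)).star_eq
  have := norm_resolventOneAdd_mul_le hh hη (x := star x) (by rwa [star_star])
  rwa [← norm_star, star_mul, star_star, hs] at this

end resolvent

/-- `y` is two-sided orthogonal to the elements of `F`. -/
def Annihilates (F : Set A) (y : A) : Prop := ∀ z ∈ F, z * y = 0 ∧ y * z = 0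

/-- No `C k` is controlled up to `δ` by a positive functional on the annihilator of `F`. -/
def Uncontrolled (C : ℕ → Set (StrongDual ℂ A)) (F : Set A) (δ : ℝ) : Prop :=
  ∀ k, ∀ ψ : A →L[ℝ] ℝ, (∀ a, 0 ≤ a → 0 ≤ ψ a) → ∃ y, ‖y‖ ≤ 1 ∧ Annihilates F y ∧
    ψ (star y * y + y * star y) ≤ 1 ∧ ∃ φ ∈ C k, δ < ‖φ y‖

theorem star_mul_self_add_nonneg (x : A) : 0 ≤ star x * x + x * star x :=
  add_nonneg (star_mul_self_nonneg x) (mul_star_self_nonneg x)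

theorem Uncontrolled.exists_seq {C : ℕ → Set (StrongDual ℂ A)} {F : Set A} {δ : ℝ}
    (h : Uncontrolled C F δ) (hC : ∀ k, ∀ φ ∈ C k, ‖φ‖ ≤ 1) (k : ℕ) {ε : ℝ} (hε : 0 < ε) :
    ∃ (x : ℕ → A) (φ : ℕ → StrongDual ℂ A) (ψ : ℕ → A →L[ℝ] ℝ),
      (∀ i, ‖x i‖ ≤ 1 ∧ Annihilates F (x i) ∧ φ i ∈ C k ∧ δ < ‖φ i (x i)‖ ∧
        IsPositiveMajorant (φ i) (ψ i)) ∧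
      ∀ j i, j < i → ψ j (star (x i) * x i + x i * star (x i)) ≤ ε := by
  classical
  obtain ⟨s, hs, hs'⟩ := exists_seq_of_forall_finset_exists
    (fun t : A × StrongDual ℂ A × (A →L[ℝ] ℝ) => ‖t.1‖ ≤ 1 ∧ Annihilates F t.1 ∧ t.2.1 ∈ C k ∧
      δ < ‖t.2.1 t.1‖ ∧ IsPositiveMajorant t.2.1 t.2.2)
    (fun t t' => t.2.2 (star t'.1 * t'.1 + t'.1 * star t'.1) ≤ ε) (fun S hS => by
      obtain ⟨y, hy, hyF, hyψ, φ, hφ, hδ⟩ := h k (ε⁻¹ • ∑ t ∈ S, t.2.2) (fun a ha => by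
        rw [smul_apply, sum_apply]
        exact smul_nonneg (inv_nonneg.2 hε.le)
          (Finset.sum_nonneg fun t ht => (hS t ht).2.2.2.2.nonneg a ha))
      obtain ⟨ψ, hψ⟩ := exists_positive_majorant φ (hC k φ hφ)
      refine ⟨⟨y, φ, ψ⟩, ⟨hy, hyF, hφ, hδ, hψ⟩, fun t ht => ?_⟩
      rw [smul_apply, sum_apply, smul_eq_mul, inv_mul_le_iff₀ hε, mul_one] at hyψ
      exact (Finset.single_le_sum (f := fun t => t.2.2 (star y * y + y * star y))
        (fun t ht => (hS t ht).2.2.2.2.nonneg _ (star_mul_self_add_nonneg y)) ht).trans hyψ)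
  exact ⟨fun i => (s i).1, fun i => (s i).2.1, fun i => (s i).2.2, hs, hs'⟩

/-- Almost orthogonal cutoffs for a finite family of contractions. -/
theorem exists_cutoffs (F : Set A) (x : ℕ → A) (hx : ∀ i, ‖x i‖ ≤ 1)
    (hxF : ∀ i, Annihilates F (x i)) (hF : ∀ z ∈ F, IsSelfAdjoint z) (m : ℕ) {η : ℝ} (hη : 0 < η) :
    ∃ f w u : ℕ → A, ∑ i ∈ Finset.range m, η • w i ≤ 1 ∧ ∀ i < m,
      (0 ≤ f i ∧ f i ≤ 1) ∧ (0 ≤ w i ∧ w i ≤ 1) ∧ (f i * (1 - w i) = 0 ∧ (1 - w i) * f i = 0) ∧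
      Annihilates F (f i) ∧ Annihilates F (w i) ∧ (0 ≤ u i ∧ u i ≤ 1) ∧
      u i ≤ (η ^ 2)⁻¹ • ∑ l ∈ Finset.Ico (i + 1) m, (star (x l) * x l + x l * star (x l)) ∧
      ‖(1 - f i - u i) * x i‖ ≤ 2 * η ∧ ‖x i * (1 - f i - u i)‖ ≤ 2 * η := by
  set a : ℕ → A := fun l => star (x l) * x l + x l * star (x l) with ha
  have ha0 : ∀ l, 0 ≤ a l := fun l => star_mul_self_add_nonneg _
  have hη2 : 0 < η ^ 2 := by positivity
  let h : ℕ → A := fun i => (η ^ 2)⁻¹ • ∑ l ∈ Finset.Ico i m, a l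
  have hh : ∀ i, 0 ≤ h i := fun i =>
    smul_nonneg (inv_nonneg.2 hη2.le) (Finset.sum_nonneg fun l _ => ha0 l)
  have hanti : ∀ i, h (i + 1) ≤ h i := fun i => by
    refine smul_le_smul_of_nonneg_left ?_ (inv_nonneg.2 hη2.le)
    exact Finset.sum_le_sum_of_subset_of_nonneg
      (Finset.Ico_subset_Ico_left (Nat.le_succ i)) fun l _ _ => ha0 l
  let g : ℕ → A := fun i => resolventOneAdd (h i)
  let d : ℕ → A := fun i => g (i + 1) - g i
  have hd : ∀ i, 0 ≤ d i := fun i => sub_nonneg.2 (resolventOneAdd_anti (hh _) (hanti i))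
  choose w hw0 hw1 hwd hfw hwf hzw hwz using fun i => exists_truncation (hd i) hη
  have hann : ∀ z ∈ F, ∀ i, z * d i = 0 ∧ d i * z = 0 := fun z hz i => by
    have hzs : star z = z := hF z hz
    have h1 : ∀ l, z * a l = 0 := fun l => by
      have e : z * star (x l) = 0 := by
        have := congrArg star (hxF l z hz).2
        rwa [star_mul, hzs, star_zero] at this
      rw [ha, mul_add, ← mul_assoc, ← mul_assoc, e, (hxF l z hz).1, zero_mul, zero_mul, add_zero]
    have h2 : ∀ l, a l * z = 0 := fun l => by
      have e : star (x l) * z = 0 := by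
        have := congrArg star (hxF l z hz).1
        rwa [star_mul, hzs, star_zero] at this
      rw [ha, add_mul, mul_assoc, mul_assoc, e, (hxF l z hz).2, mul_zero, mul_zero, add_zero]
    have h3 : ∀ i, z * h i = 0 := fun i => by simp [h, Finset.mul_sum, h1]
    have h4 : ∀ i, h i * z = 0 := fun i => by simp [h, Finset.sum_mul, h2]
    constructor
    · simp only [d, g, mul_sub, mul_resolventOneAdd_of_mul_eq_zero (hh _) (h3 _), sub_self]
    · simp only [d, g, sub_mul, resolventOneAdd_mul_of_mul_eq_zero (hh _) (h4 _), sub_self]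
  have hAw : ∀ i, Annihilates F (w i) := fun i z hz =>
    ⟨hzw i z (hann z hz i).1, hwz i z (hann z hz i).2⟩
  have hg0 : ∀ i, 0 ≤ g i := fun i => resolventOneAdd_nonneg (hh i)
  have hg1 : ∀ i, g i ≤ 1 := fun i => resolventOneAdd_le_one (hh i)
  refine ⟨fun i => d i - η • w i, w, fun i => 1 - g (i + 1), ?_, fun i hi =>
    ⟨⟨sub_nonneg.2 (hwd i), ?_⟩, ⟨hw0 i, hw1 i⟩, ⟨hfw i, hwf i⟩, ?_, hAw i,
      ⟨sub_nonneg.2 (hg1 _), sub_le_self _ (hg0 _)⟩, one_sub_resolventOneAdd_le (hh _), ?_⟩⟩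
  · refine (Finset.sum_le_sum fun i _ => hwd i).trans ?_
    rw [Finset.sum_range_sub]
    exact (sub_le_self _ (hg0 0)).trans (hg1 m)
  · exact (sub_le_self _ (smul_nonneg hη.le (hw0 i))).trans
      ((sub_le_self _ (hg0 i)).trans (hg1 _))
  · intro z hz
    simp [mul_sub, sub_mul, hann z hz i, hAw i z hz]
  · have e : 1 - (d i - η • w i) - (1 - g (i + 1)) = g i + η • w i := by
      simp only [d]
      abel
    rw [e]
    have hai : a i ≤ η ^ 2 • h i := by
      rw [smul_inv_smul₀ hη2.ne']
      exact Finset.single_le_sum (fun l _ => ha0 l) (Finset.mem_Ico.2 ⟨le_rfl, hi⟩)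
    have hw : ‖w i‖ ≤ 1 := (CStarAlgebra.norm_le_one_iff_of_nonneg _ (hw0 i)).2 (hw1 i)
    have hb1 : ‖g i * x i‖ ≤ η := norm_resolventOneAdd_mul_le (hh i) hη.le
      ((le_add_of_nonneg_left (star_mul_self_nonneg _)).trans hai)
    have hb2 : ‖x i * g i‖ ≤ η := norm_mul_resolventOneAdd_le (hh i) hη.le
      ((le_add_of_nonneg_right (mul_star_self_nonneg _)).trans hai)
    rw [add_mul, mul_add, smul_mul_assoc, mul_smul_comm, two_mul]
    constructor
    · refine (norm_add_le _ _).trans (add_le_add hb1 ?_)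
      rw [norm_smul, Real.norm_of_nonneg hη.le]
      exact mul_le_of_le_one_right hη.le ((norm_mul_le _ _).trans
        (mul_le_one₀ hw (norm_nonneg _) (hx i)))
    · refine (norm_add_le _ _).trans (add_le_add hb2 ?_)
      rw [norm_smul, Real.norm_of_nonneg hη.le]
      exact mul_le_of_le_one_right hη.le ((norm_mul_le _ _).trans
        (mul_le_one₀ (hx i) (norm_nonneg _) hw))

theorem norm_apply_sub_apply_cutoff_le {φ : StrongDual ℂ A} (hφ : ‖φ‖ ≤ 1) {ψ : A →L[ℝ] ℝ}
    (hψ : IsPositiveMajorant φ ψ) {x f u : A} {η : ℝ} (hη : 0 ≤ η) (hx : ‖x‖ ≤ 1)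
    (hf0 : 0 ≤ f) (hf1 : f ≤ 1) (hu0 : 0 ≤ u) (hu1 : u ≤ 1) (hψu : ψ u ≤ η ^ 2)
    (h1 : ‖(1 - f - u) * x‖ ≤ 2 * η) (h2 : ‖x * (1 - f - u)‖ ≤ 2 * η) :
    ‖φ x - φ (f * x * f)‖ ≤ 6 * η := by
  have hφ' : ∀ y, ‖φ y‖ ≤ ‖y‖ := fun y => (φ.le_opNorm y).trans
    ((mul_le_mul_of_nonneg_right hφ (norm_nonneg y)).trans_eq (one_mul _))
  have hf : ‖f‖ ≤ 1 := (CStarAlgebra.norm_le_one_iff_of_nonneg _ hf0).2 hf1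
  have hfx : ‖f * x‖ ≤ 1 := (norm_mul_le _ _).trans (mul_le_one₀ hf (norm_nonneg _) hx)
  have e : x - f * x * f = (u * x + (1 - f - u) * x)
      + (f * x * u + f * (x * (1 - f - u))) := by noncomm_ring
  have b1 : ‖φ (u * x)‖ ≤ η := (sq_le_sq₀ (norm_nonneg _) hη).1
    ((norm_apply_mul_sq_le_of_majorant hψ hu0 hu1 hx).2.trans hψu)
  have b2 : ‖φ (f * x * u)‖ ≤ η := (sq_le_sq₀ (norm_nonneg _) hη).1
    ((norm_apply_mul_sq_le_of_majorant hψ hu0 hu1 hfx).1.trans hψu)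
  have b3 := (hφ' _).trans h1
  have b4 : ‖φ (f * (x * (1 - f - u)))‖ ≤ 2 * η := (hφ' _).trans ((norm_mul_le _ _).trans
    ((mul_le_of_le_one_left (norm_nonneg _) hf).trans h2))
  rw [← map_sub, e, map_add, map_add, map_add]
  refine (norm_add_le _ _).trans ((add_le_add (norm_add_le _ _) (norm_add_le _ _)).trans ?_)
  linarith

theorem conjugate_star_mul_self_add_le {c y : A} (h0 : 0 ≤ c) (h1 : c ≤ 1) :
    star (c * y * c) * (c * y * c) + c * y * c * star (c * y * c) ≤
      c * (star y * y + y * star y) * c := by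
  have hc : star c = c := (IsSelfAdjoint.of_nonneg h0).star_eq
  have hcc : c * c ≤ 1 := (mul_self_le_self_of_le_one h0 h1).trans h1
  have key : ∀ z : A, c * star z * (c * c) * z * c ≤ c * (star z * z) * c := fun z => by
    have := star_left_conjugate_le_conjugate hcc (z * c)
    simpa [star_mul, hc, mul_assoc] using this
  have k1 := key y
  have k2 := key (star y)
  rw [star_star] at k2
  rw [mul_add, add_mul, star_mul, star_mul, hc]
  refine add_le_add (le_of_eq_of_le ?_ k1) (le_of_eq_of_le ?_ k2) <;> simp only [mul_assoc]

theorem Uncontrolled.exists_insert {C : ℕ → Set (StrongDual ℂ A)} {F : Set A} {δ η : ℝ}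
    (h : Uncontrolled C F (δ + 8 * η)) (hanti : Antitone C) (hC : ∀ k, ∀ φ ∈ C k, ‖φ‖ ≤ 1)
    (hη : 0 < η) {m : ℕ} (hm : 1 ≤ η ^ 3 * m) {f w : ℕ → A}
    (hsum : ∑ i ∈ Finset.range m, η • w i ≤ 1) (hw : ∀ i < m, 0 ≤ w i ∧ w i ≤ 1)
    (hfw : ∀ i < m, f i * (1 - w i) = 0 ∧ (1 - w i) * f i = 0)
    (hwF : ∀ i < m, Annihilates F (w i)) :
    ∃ i < m, Uncontrolled C (insert (f i) F) δ := by
  by_contra! H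
  unfold Uncontrolled at H
  push Not at H
  choose! k ψ hψ hK using H
  have hc0 : ∀ i < m, 0 ≤ 1 - w i := fun i hi => sub_nonneg.2 (hw i hi).2
  have hc1 : ∀ i < m, 1 - w i ≤ 1 := fun i hi => sub_le_self _ (hw i hi).1
  have hconj : ∀ i < m, ∀ a, 0 ≤ a → 0 ≤ (1 - w i) * a * (1 - w i) := fun i hi a ha => by
    have := star_left_conjugate_nonneg ha (1 - w i)
    rwa [(IsSelfAdjoint.of_nonneg (hc0 i hi)).star_eq] at this
  let Ψ : A →L[ℝ] ℝ := ∑ i ∈ Finset.range m,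
    (ψ i).comp (ContinuousLinearMap.mulLeftRight ℝ A (1 - w i) (1 - w i))
  have hΨ : ∀ a, Ψ a = ∑ i ∈ Finset.range m, ψ i ((1 - w i) * a * (1 - w i)) := fun a => by
    simp only [Ψ, sum_apply, ContinuousLinearMap.comp_apply, ContinuousLinearMap.mulLeftRight_apply]
  have hterm : ∀ a, 0 ≤ a → ∀ i ∈ Finset.range m, 0 ≤ ψ i ((1 - w i) * a * (1 - w i)) :=
    fun a ha i hi => hψ i (Finset.mem_range.1 hi) _ (hconj i (Finset.mem_range.1 hi) a ha)
  obtain ⟨y, hy, hyF, hyΨ, φ, hφ, hlt⟩ := h ((Finset.range m).sup k) Ψ fun a ha => by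
    rw [hΨ]
    exact Finset.sum_nonneg (hterm a ha)
  obtain ⟨ψ', hψ'⟩ := exists_positive_majorant φ (hC _ φ hφ)
  have hm0 : 0 < m := by
    rcases Nat.eq_zero_or_pos m with rfl | hm0
    · norm_num at hm
    · exact hm0
  obtain ⟨i, hi, hwi⟩ : ∃ i ∈ Finset.range m, ψ' (w i) ≤ 2 * η ^ 2 := by
    refine Finset.exists_le_of_sum_le (Finset.nonempty_range_iff.2 hm0.ne') ?_
    have h1 : ψ' (∑ i ∈ Finset.range m, η • w i) ≤ 2 := by
      refine (hψ'.mono hsum).trans ((hψ'.le_two_mul_norm 1).trans ?_)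
      have : ‖(1 : A)‖ ≤ 1 := by
        rcases subsingleton_or_nontrivial A with hA | hA
        · simp [Subsingleton.elim (1 : A) 0]
        · simp
      linarith
    simp only [map_sum, map_smul, smul_eq_mul, ← Finset.mul_sum] at h1
    rw [Finset.sum_const, Finset.card_range, nsmul_eq_mul]
    refine le_of_mul_le_mul_left (h1.trans ?_) hη
    calc (2 : ℝ) ≤ 2 * (η ^ 3 * m) := by linarith
      _ = η * (m * (2 * η ^ 2)) := by ring
  have him := Finset.mem_range.1 hi
  have hcn : ‖1 - w i‖ ≤ 1 := (CStarAlgebra.norm_le_one_iff_of_nonneg _ (hc0 i him)).2 (hc1 i him)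
  have hyc : ‖y * (1 - w i)‖ ≤ 1 := (norm_mul_le _ _).trans (mul_le_one₀ hy (norm_nonneg _) hcn)
  have hy' : ‖(1 - w i) * y * (1 - w i)‖ ≤ 1 := by
    rw [mul_assoc]
    exact (norm_mul_le _ _).trans (mul_le_one₀ hcn (norm_nonneg _) hyc)
  have hy'F : Annihilates (insert (f i) F) ((1 - w i) * y * (1 - w i)) := by
    rintro z (rfl | hz)
    · simp only [mul_assoc, (hfw i him).2, mul_zero, and_true]
      rw [← mul_assoc, (hfw i him).1, zero_mul]
    · have e1 : z * (1 - w i) = z := by rw [mul_sub, mul_one, (hwF i him z hz).1, sub_zero]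
      have e2 : (1 - w i) * z = z := by rw [sub_mul, one_mul, (hwF i him z hz).2, sub_zero]
      rw [← mul_assoc, ← mul_assoc, e1, (hyF z hz).1, zero_mul, mul_assoc, e2, mul_assoc,
        (hyF z hz).2, mul_zero]
      exact ⟨rfl, rfl⟩
  have hψi : ψ i (star ((1 - w i) * y * (1 - w i)) * ((1 - w i) * y * (1 - w i))
      + (1 - w i) * y * (1 - w i) * star ((1 - w i) * y * (1 - w i))) ≤ 1 := by
    have h1 := hψ i him _
      (sub_nonneg.2 (conjugate_star_mul_self_add_le (y := y) (hc0 i him) (hc1 i him)))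
    rw [map_sub, sub_nonneg] at h1
    refine h1.trans (le_trans ?_ ((hΨ _).symm.trans_le hyΨ))
    exact Finset.single_le_sum
      (f := fun i => ψ i ((1 - w i) * (star y * y + y * star y) * (1 - w i)))
      (hterm _ (star_mul_self_add_nonneg y)) hi
  have hfin := hK i him _ hy' hy'F hψi φ (hanti (Finset.le_sup hi) hφ)
  have b1 : ‖φ (y * w i)‖ ^ 2 ≤ 2 * η ^ 2 :=
    (norm_apply_mul_sq_le_of_majorant hψ' (hw i him).1 (hw i him).2 hy).1.trans hwi
  have b2 : ‖φ (w i * (y * (1 - w i)))‖ ^ 2 ≤ 2 * η ^ 2 :=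
    (norm_apply_mul_sq_le_of_majorant hψ' (hw i him).1 (hw i him).2 hyc).2.trans hwi
  have b1' : ‖φ (y * w i)‖ ≤ 4 * η := by nlinarith [norm_nonneg (φ (y * w i))]
  have b2' : ‖φ (w i * (y * (1 - w i)))‖ ≤ 4 * η := by
    nlinarith [norm_nonneg (φ (w i * (y * (1 - w i))))]
  have e : y = (1 - w i) * y * (1 - w i) + y * w i + w i * (y * (1 - w i)) := by noncomm_ring
  have : ‖φ y‖ ≤ δ + 8 * η := by
    rw [e, map_add, map_add]
    refine (norm_add₃_le).trans ?_
    linarith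
  exact hlt.not_ge this

theorem Uncontrolled.exists_split {C : ℕ → Set (StrongDual ℂ A)} {F : Set A} {δ η : ℝ}
    (h : Uncontrolled C F (δ + 8 * η)) (hanti : Antitone C) (hC : ∀ k, ∀ φ ∈ C k, ‖φ‖ ≤ 1)
    (hF : ∀ z ∈ F, IsSelfAdjoint z) (hη : 0 < η) (k : ℕ) :
    ∃ (f x : A) (φ : StrongDual ℂ A), 0 ≤ f ∧ f ≤ 1 ∧ Annihilates F f ∧ ‖x‖ ≤ 1 ∧ φ ∈ C k ∧
      δ < ‖φ (f * x * f)‖ ∧ Uncontrolled C (insert f F) δ := by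
  obtain ⟨m, hm⟩ := exists_nat_ge (1 / η ^ 3)
  rw [div_le_iff₀' (by positivity)] at hm
  have hm0 : 0 < (m : ℝ) := by
    by_contra! h0
    have := mul_nonpos_of_nonneg_of_nonpos (pow_nonneg hη.le 3) h0
    linarith
  obtain ⟨x, φ, ψ, hx, hψ⟩ := h.exists_seq hC k (ε := η ^ 4 / m) (by positivity)
  obtain ⟨f, w, u, hsum, hcut⟩ :=
    exists_cutoffs F x (fun i => (hx i).1) (fun i => (hx i).2.1) hF m hη
  obtain ⟨i, hi, hU⟩ := h.exists_insert hanti hC hη hm (f := f) (w := w) hsum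
    (fun i hi => (hcut i hi).2.1) (fun i hi => (hcut i hi).2.2.1)
    (fun i hi => (hcut i hi).2.2.2.2.1)
  obtain ⟨⟨hf0, hf1⟩, -, -, hfF, -, ⟨hu0, hu1⟩, hua, h1, h2⟩ := hcut i hi
  obtain ⟨hxi, -, hφC, hδ, hmaj⟩ := hx i
  refine ⟨f i, x i, φ i, hf0, hf1, hfF, hxi, hφC, ?_, hU⟩
  have hψu : ψ i (u i) ≤ η ^ 2 := by
    refine (hmaj.mono hua).trans ?_
    rw [map_smul, map_sum, smul_eq_mul, inv_mul_le_iff₀ (by positivity)]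
    calc _ ≤ ∑ l ∈ Finset.Ico (i + 1) m, η ^ 4 / m :=
          Finset.sum_le_sum fun l hl => hψ i l (Finset.mem_Ico.1 hl).1
      _ = ((m - (i + 1) : ℕ) : ℝ) * (η ^ 4 / m) := by
        rw [Finset.sum_const, Nat.card_Ico, nsmul_eq_mul]
      _ ≤ m * (η ^ 4 / m) := by
        gcongr
        exact Nat.sub_le _ _
      _ = η ^ 2 * η ^ 2 := by field_simp
  have := norm_apply_sub_apply_cutoff_le (hC k _ hφC) hmaj hη.le hxi hf0 hf1 hu0 hu1 hψu h1 h2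
  have := norm_sub_norm_le (φ i (x i)) (φ i (f i * x i * f i))
  linarith

/-- An uncontrolled sequence of sets of functionals is not small on orthogonal blocks. -/
theorem Uncontrolled.exists_orthogonal_blocks {C : ℕ → Set (StrongDual ℂ A)} {δ : ℝ}
    (hδ : 0 < δ) (h : Uncontrolled C ∅ δ) (hanti : Antitone C) (hC : ∀ k, ∀ φ ∈ C k, ‖φ‖ ≤ 1) :
    ∃ (f x : ℕ → A) (φ : ℕ → StrongDual ℂ A), (∀ i, 0 ≤ f i ∧ f i ≤ 1) ∧ (∀ i, ‖x i‖ ≤ 1) ∧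
      (∀ i j, i ≠ j → f i * f j = 0) ∧ (∀ i, φ i ∈ C i) ∧
      ∀ i, δ / 2 < ‖φ i (f i * x i * f i)‖ := by
  let σ := {p : Set A × ℝ // (∀ z ∈ p.1, IsSelfAdjoint z) ∧ δ / 2 < p.2 ∧ Uncontrolled C p.1 p.2}
  have step : ∀ (p : σ) (k : ℕ), ∃ (f x : A) (φ : StrongDual ℂ A) (q : σ), 0 ≤ f ∧ f ≤ 1 ∧
      Annihilates p.1.1 f ∧ ‖x‖ ≤ 1 ∧ φ ∈ C k ∧ δ / 2 < ‖φ (f * x * f)‖ ∧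
      q.1.1 = insert f p.1.1 := by
    rintro ⟨⟨F, δ'⟩, hF, hδ', hU⟩ k
    simp only at hF hδ' hU
    set η := (δ' - δ / 2) / 16 with hη
    have hη0 : 0 < η := by linarith
    have e : δ' = (δ' - 8 * η) + 8 * η := by ring
    rw [e] at hU
    obtain ⟨f, x, φ, hf0, hf1, hfF, hx, hφ, hlt, hU'⟩ := hU.exists_split hanti hC hF hη0 k
    refine ⟨f, x, φ, ⟨(insert f F, δ' - 8 * η), ?_, by simp only; linarith, hU'⟩, hf0, hf1,
      hfF, hx, hφ, by linarith, rfl⟩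
    rintro z (rfl | hz)
    · exact .of_nonneg hf0
    · exact hF z hz
  choose f x φ q hf0 hf1 hfF hx hφ hlt hq using step
  let p₀ : σ := ⟨(∅, δ), fun z hz => hz.elim, by simp only; linarith, h⟩
  let s : ℕ → σ := fun n => Nat.rec p₀ (fun n p => q p n) n
  have hs : ∀ n, (s (n + 1)).1.1 = insert (f (s n) n) (s n).1.1 := fun n => hq (s n) n
  have hmem : ∀ i j, i < j → f (s i) i ∈ (s j).1.1 := by
    intro i j hij
    induction j, hij using Nat.le_induction with
    | base => rw [hs]; exact Set.mem_insert _ _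
    | succ j _ ih => rw [hs]; exact Set.mem_insert_of_mem _ ih
  refine ⟨fun n => f (s n) n, fun n => x (s n) n, fun n => φ (s n) n,
    fun i => ⟨hf0 _ _, hf1 _ _⟩, fun i => hx _ _, fun i j hij => ?_, fun i => hφ _ _,
    fun i => hlt _ _⟩
  rcases hij.lt_or_gt with hij | hij
  · exact (hfF (s j) j _ (hmem i j hij)).1
  · exact (hfF (s i) i _ (hmem j i hij)).2

end CStar

section Phillips
variable {X : Type*} [NormedAddCommGroup X] [NormedSpace ℂ X]

/-- The finitely additive vector measures on `ℕ` of semivariation at most one. -/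
structure IsContractiveVectorMeasure (S : Set ℕ → X) : Prop where
  union : ∀ A B, Disjoint A B → S (A ∪ B) = S A + S B
  norm_sum_le : ∀ (s : Finset ℕ) (B : ℕ → Set ℕ) (z : ℕ → ℂ),
    Pairwise (fun i j => Disjoint (B i) (B j)) → (∀ i, ‖z i‖ ≤ 1) → ‖∑ i ∈ s, z i • S (B i)‖ ≤ 1

theorem IsContractiveVectorMeasure.exists_infinite_subset {S : Set ℕ → X}
    (hS : IsContractiveVectorMeasure S) {φ : StrongDual ℂ X} (hφ : ‖φ‖ ≤ 1) {A : Set ℕ}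
    (hA : A.Infinite) {ε : ℝ} (hε : 0 < ε) :
    ∃ A' ⊆ A, A'.Infinite ∧ ∀ B ⊆ A', ‖φ (S B)‖ ≤ ε := by
  by_contra! H
  let e := hA.natEmbedding
  let P : ℕ → Set ℕ := fun j => Set.range fun k => (e (Nat.pair j k) : ℕ)
  have hP : ∀ j, P j ⊆ A := by
    rintro j _ ⟨k, rfl⟩
    exact (e _).2
  have hinf : ∀ j, (P j).Infinite := fun j => Set.infinite_range_of_injective fun k k' h => by
    simpa using e.injective (Subtype.ext h)
  choose B hB hlt using fun j => H (P j) (hP j) (hinf j)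
  have hdisj : Pairwise fun i j => Disjoint (B i) (B j) := fun i j hij => by
    refine Set.disjoint_left.2 fun n hi hj => hij ?_
    obtain ⟨k, hk⟩ := hB i hi
    obtain ⟨l, hl⟩ := hB j hj
    have := e.injective (Subtype.ext (hk.trans hl.symm))
    simp only [Nat.pair_eq_pair] at this
    exact this.1
  choose z hz hzφ using fun j => RCLike.exists_norm_eq_mul_self (φ (S (B j)))
  obtain ⟨M, hM⟩ := exists_nat_gt (1 / ε)
  rw [div_lt_iff₀ hε] at hM
  have h1 := (φ.le_of_opNorm_le_of_le hφ
    (hS.norm_sum_le (Finset.range M) B z hdisj fun i => (hz i).le))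
  have h2 : φ (∑ i ∈ Finset.range M, z i • S (B i)) =
      ((∑ i ∈ Finset.range M, ‖φ (S (B i))‖ : ℝ) : ℂ) := by
    rw [map_sum, Complex.ofReal_sum]
    exact Finset.sum_congr rfl fun i _ => by rw [map_smul, smul_eq_mul]; exact (hzφ i).symm
  rw [h2, Complex.norm_real, Real.norm_of_nonneg (Finset.sum_nonneg fun _ _ => norm_nonneg _)] at h1
  have h3 : ∑ i ∈ Finset.range M, ε ≤ ∑ i ∈ Finset.range M, ‖φ (S (B i))‖ :=
    Finset.sum_le_sum fun i _ => (hlt i).le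
  rw [Finset.sum_const, Finset.card_range, nsmul_eq_mul] at h3
  linarith

/-- A form of Phillips' lemma. -/
theorem IsContractiveVectorMeasure.exists_norm_apply_singleton_le {S : Set ℕ → X}
    (hS : IsContractiveVectorMeasure S) {C : ℕ → Set (StrongDual ℂ X)} (hanti : Antitone C)
    (hC : ∀ k, ∀ φ ∈ C k, ‖φ‖ ≤ 1) (hsmall : ∀ x, ∀ ε > 0, ∃ k, ∀ φ ∈ C k, ‖φ x‖ ≤ ε)
    {φ : ℕ → StrongDual ℂ X} (hφ : ∀ k, φ k ∈ C k) {ε : ℝ} (hε : 0 < ε) :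
    ∃ k, ‖φ k (S {k})‖ ≤ ε := by
  by_contra! H
  let σ := {p : Set ℕ × Set ℕ // p.2.Infinite}
  have step : ∀ p : σ, ∃ (n : ℕ) (q : σ), n ∈ p.1.2 ∧ ‖φ n (S p.1.1)‖ ≤ ε / 4 ∧
      q.1.1 = insert n p.1.1 ∧ q.1.2 ⊆ p.1.2 ∧ (∀ k ∈ q.1.2, n < k) ∧
      ∀ B ⊆ q.1.2, ‖φ n (S B)‖ ≤ ε / 4 := by
    rintro ⟨⟨P, A⟩, hA⟩
    obtain ⟨k, hk⟩ := hsmall (S P) (ε / 4) (by positivity)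
    obtain ⟨n, hnA, hkn⟩ := hA.exists_gt k
    have hA' : (A \ Set.Iic n).Infinite := hA.sdiff (Set.finite_Iic n)
    obtain ⟨A', hA'A, hinf, hB⟩ :=
      hS.exists_infinite_subset (hC n _ (hφ n)) hA' (ε := ε / 4) (by positivity)
    exact ⟨n, ⟨(insert n P, A'), hinf⟩, hnA, hk _ (hanti hkn.le (hφ n)), rfl,
      fun i hi => (hA'A hi).1, fun i hi => not_le.1 (hA'A hi).2, hB⟩
  choose n q hnA hP hq hqA hlt hB using step
  let p₀ : σ := ⟨(∅, Set.univ), Set.infinite_univ⟩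
  let s : ℕ → σ := fun i => Nat.rec p₀ (fun _ p => q p) i
  have hmono : ∀ i j, i ≤ j → (s j).1.2 ⊆ (s i).1.2 := by
    intro i j hij
    induction j, hij using Nat.le_induction with
    | base => exact subset_rfl
    | succ j _ ih => exact (hqA (s j)).trans ih
  have hmem : ∀ i j, i < j → n (s j) ∈ (s (i + 1)).1.2 := fun i j hij => hmono _ _ hij (hnA _)
  have hprev : ∀ i, (s i).1.1 = {m | ∃ j < i, n (s j) = m} := by
    intro i
    induction i with
    | zero => ext m; simp [s, p₀]
    | succ i ih =>
      rw [show (s (i + 1)).1.1 = insert (n (s i)) (s i).1.1 from hq (s i), ih]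
      ext m
      simp only [Set.mem_insert_iff, Set.mem_ofPred_eq, Nat.lt_succ_iff_lt_or_eq, or_and_right,
        exists_or, exists_eq_left]
      rw [or_comm, eq_comm]
  have hstrict : StrictMono fun i => n (s i) := fun i j hij => hlt (s i) _ (hmem i j hij)
  let R : ℕ → Set ℕ := fun i => {m | ∃ j, i < j ∧ n (s j) = m}
  have hR : ∀ i, R i ⊆ (q (s i)).1.2 := by
    rintro i _ ⟨j, hij, rfl⟩
    exact hmem i j hij
  have hD : ∀ i, S (Set.range fun i => n (s i)) = S (s i).1.1 + S {n (s i)} + S (R i) := by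
    intro i
    rw [← hS.union, ← hS.union]
    · congr 1
      rw [hprev]
      ext m
      simp only [Set.mem_range, Set.mem_union, Set.mem_ofPred_eq, Set.mem_singleton_iff, R]
      constructor
      · rintro ⟨j, rfl⟩
        rcases lt_trichotomy j i with h | rfl | h
        · exact .inl (.inl ⟨j, h, rfl⟩)
        · exact .inl (.inr rfl)
        · exact .inr ⟨j, h, rfl⟩
      · rintro ((⟨j, -, h⟩ | h) | ⟨j, -, h⟩)
        exacts [⟨j, h⟩, ⟨i, h.symm⟩, ⟨j, h⟩]
    · rw [hprev, Set.disjoint_left]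
      rintro m (⟨j, hj, rfl⟩ | h) ⟨l, hl, h'⟩
      · exact (hstrict (hj.trans hl)).ne' h'
      · exact (hstrict hl).ne' (h'.trans h)
    · rw [hprev, Set.disjoint_singleton_right]
      rintro ⟨j, hj, h⟩
      exact (hstrict hj).ne h
  obtain ⟨k, hk⟩ := hsmall (S (Set.range fun i => n (s i))) (ε / 4) (by positivity)
  have h1 := hk _ (hanti (hstrict.id_le k) (hφ (n (s k))))
  have h2 := hP (s k)
  have h3 := hB (s k) _ (hR k)
  have h4 := H (n (s k))
  have h5 : φ (n (s k)) (S {n (s k)}) = φ (n (s k)) (S (Set.range fun i => n (s i)))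
      - φ (n (s k)) (S (s k).1.1) - φ (n (s k)) (S (R k)) := by
    rw [hD k, map_add, map_add]
    ring
  rw [h5] at h4
  have h6 := norm_sub_le (φ (n (s k)) (S (Set.range fun i => n (s i))) - φ (n (s k)) (S (s k).1.1))
    (φ (n (s k)) (S (R k)))
  have h7 := norm_sub_le (φ (n (s k)) (S (Set.range fun i => n (s i)))) (φ (n (s k)) (S (s k).1.1))
  linarith

end Phillips

theorem norm_sum_le_one_of_mul_eq_zero {A : Type*} [CStarAlgebra A] [PartialOrder A]
    [StarOrderedRing A] {f : ℕ → A} (hf : ∀ i, 0 ≤ f i ∧ f i ≤ 1)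
    (horth : ∀ i j, i ≠ j → f i * f j = 0) (s : Finset ℕ) : ‖∑ i ∈ s, f i‖ ≤ 1 := by
  have h0 : 0 ≤ ∑ i ∈ s, f i := Finset.sum_nonneg fun i _ => (hf i).1
  have hsq : (∑ i ∈ s, f i) * ∑ i ∈ s, f i = ∑ i ∈ s, f i * f i := by
    rw [Finset.sum_mul_sum]
    exact Finset.sum_congr rfl fun i hi =>
      Finset.sum_eq_single_of_mem i hi fun j _ hj => horth i j hj.symm
  have hle : (∑ i ∈ s, f i) * ∑ i ∈ s, f i ≤ ∑ i ∈ s, f i :=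
    hsq.trans_le (Finset.sum_le_sum fun i _ => mul_self_le_self_of_le_one (hf i).1 (hf i).2)
  have hs : star (∑ i ∈ s, f i) = ∑ i ∈ s, f i := (IsSelfAdjoint.of_nonneg h0).star_eq
  have hn : ‖(∑ i ∈ s, f i) * ∑ i ∈ s, f i‖ ≤ ‖∑ i ∈ s, f i‖ :=
    CStarAlgebra.norm_le_norm_of_nonneg_of_le (hsq ▸ Finset.sum_nonneg fun i _ => by
      have := star_mul_self_nonneg (f i)
      rwa [(IsSelfAdjoint.of_nonneg (hf i).1).star_eq] at this) hle
  have := CStarRing.norm_star_mul_self (x := ∑ i ∈ s, f i)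
  rw [hs] at this
  rw [this] at hn
  by_contra! h
  nlinarith

section Hilbert
variable {H : Type*} [NormedAddCommGroup H] [InnerProductSpace ℂ H]

theorem norm_sum_sq_of_pairwise_inner_eq_zero {w : ℕ → H}
    (hw : ∀ i j, i ≠ j → inner ℂ (w i) (w j) = 0) (s : Finset ℕ) :
    ‖∑ i ∈ s, w i‖ ^ 2 = ∑ i ∈ s, ‖w i‖ ^ 2 := by
  have h : inner ℂ (∑ i ∈ s, w i) (∑ i ∈ s, w i) = ∑ i ∈ s, inner ℂ (w i) (w i) := by
    rw [sum_inner]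
    refine Finset.sum_congr rfl fun i hi => ?_
    rw [inner_sum]
    exact Finset.sum_eq_single_of_mem i hi fun j _ hj => hw i j hj.symm
  simp only [inner_self_eq_norm_sq_to_K] at h
  exact_mod_cast h

variable [CompleteSpace H]

theorem exists_hasSum_of_orthogonal {g : ℕ → H →L[ℂ] H}
    (horth : ∀ i j, i ≠ j → ∀ v, inner ℂ (g i v) (g j v) = 0)
    (hsq : ∀ v (s : Finset ℕ), ∑ i ∈ s, ‖g i v‖ ^ 2 ≤ ‖v‖ ^ 2) :
    ∃ G : H →L[ℂ] H, ‖G‖ ≤ 1 ∧ ∀ v, HasSum (fun i => g i v) (G v) := by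
  have hsum : ∀ v, Summable fun i => g i v := fun v => by
    have h2 : Summable fun i => ‖g i v‖ ^ 2 :=
      summable_of_sum_le (fun i => sq_nonneg _) (hsq v)
    rw [summable_iff_vanishing_norm] at h2 ⊢
    intro ε hε
    obtain ⟨s, hs⟩ := h2 (ε ^ 2) (by positivity)
    refine ⟨s, fun t ht => ?_⟩
    have := (le_abs_self _).trans_lt (hs t ht)
    rw [← norm_sum_sq_of_pairwise_inner_eq_zero (fun i j hij => horth i j hij v)] at this
    exact lt_of_pow_lt_pow_left₀ 2 hε.le this
  have htend : Tendsto (fun (s : Finset ℕ) v => (∑ i ∈ s, g i : H →L[ℂ] H).toLinearMap v) atTop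
      (𝓝 fun v => ∑' i, g i v) := by
    rw [tendsto_pi_nhds]
    intro v
    simp only [ContinuousLinearMap.coe_coe, sum_apply]
    exact (hsum v).hasSum
  let G₀ := linearMapOfTendsto _ _ htend
  have hG₀ : ∀ v, ‖G₀ v‖ ≤ 1 * ‖v‖ := fun v => by
    rw [one_mul]
    refine le_of_tendsto (hsum v).hasSum.norm (Eventually.of_forall fun s => ?_)
    refine le_of_sq_le_sq ?_ (norm_nonneg v)
    rw [norm_sum_sq_of_pairwise_inner_eq_zero (fun i j hij => horth i j hij v)]
    exact hsq v s
  exact ⟨G₀.mkContinuous 1 hG₀, LinearMap.mkContinuous_norm_le _ zero_le_one _,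
    fun v => (hsum v).hasSum⟩

/-- Orthogonal blocks in `L(H)` glue to a vector measure. -/
theorem exists_isContractiveVectorMeasure {f x : ℕ → H →L[ℂ] H} (hf : ∀ i, 0 ≤ f i ∧ f i ≤ 1)
    (hx : ∀ i, ‖x i‖ ≤ 1) (horth : ∀ i j, i ≠ j → f i * f j = 0) :
    ∃ S : Set ℕ → H →L[ℂ] H, IsContractiveVectorMeasure S ∧ ∀ k, S {k} = f k * x k * f k := by
  have hsymm : ∀ i u v, inner ℂ (f i u) v = inner ℂ u (f i v) := fun i u v => by
    have := (IsSelfAdjoint.of_nonneg (hf i).1).adjoint_eq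
    conv_lhs => rw [← this]
    exact ContinuousLinearMap.adjoint_inner_left _ _ _
  have hinner : ∀ i j, i ≠ j → ∀ u v, inner ℂ (f i u) (f j v) = 0 := fun i j hij u v => by
    rw [hsymm, show f i (f j v) = (f i * f j) v from rfl, horth i j hij]
    simp
  have hfn : ∀ i, ‖f i‖ ≤ 1 := fun i =>
    (CStarAlgebra.norm_le_one_iff_of_nonneg _ (hf i).1).2 (hf i).2
  have hsq : ∀ v (s : Finset ℕ), ∑ i ∈ s, ‖f i v‖ ^ 2 ≤ ‖v‖ ^ 2 := fun v s => by
    rw [← norm_sum_sq_of_pairwise_inner_eq_zero (fun i j hij => hinner i j hij v v), ← sum_apply]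
    have := (∑ i ∈ s, f i).le_of_opNorm_le (norm_sum_le_one_of_mul_eq_zero hf horth s) v
    rw [one_mul] at this
    gcongr
  let g : (ℕ → ℂ) → ℕ → H →L[ℂ] H := fun c i => c i • (f i * x i * f i)
  have hg : ∀ c i v, g c i v = c i • f i (x i (f i v)) := fun _ _ _ => rfl
  have hex : ∀ c : ℕ → ℂ, (∀ i, ‖c i‖ ≤ 1) →
      ∃ G : H →L[ℂ] H, ‖G‖ ≤ 1 ∧ ∀ v, HasSum (fun i => g c i v) (G v) := fun c hc => by
    refine exists_hasSum_of_orthogonal (fun i j hij v => ?_) fun v s => ?_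
    · rw [hg, hg, ← map_smul (f i), ← map_smul (f j)]
      exact hinner i j hij _ _
    · refine le_trans (Finset.sum_le_sum fun i _ => ?_) (hsq v s)
      have h1 := (f i).le_of_opNorm_le (hfn i) (x i (f i v))
      have h2 := (x i).le_of_opNorm_le (hx i) (f i v)
      have h3 := mul_le_mul (hc i) (h1.trans (by linarith : _ ≤ 1 * ‖f i v‖)) (norm_nonneg _)
        zero_le_one
      rw [hg, norm_smul]
      gcongr
      linarith
  have hind : ∀ (B : Set ℕ) i, ‖B.indicator (1 : ℕ → ℂ) i‖ ≤ 1 := fun B i =>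
    (norm_indicator_le_norm_self _ _).trans (by simp)
  choose S hS1 hS using fun B : Set ℕ => hex (B.indicator 1) (hind B)
  refine ⟨S, ⟨fun A B hAB => ?_, fun s B z hB hz => ?_⟩, fun k => ?_⟩
  · ext v
    refine (hS _ v).unique ?_
    rw [add_apply]
    convert (hS A v).add (hS B v) using 2 with i
    rw [hg, hg, hg, Set.indicator_union_of_disjoint hAB, add_smul]
  · let c : ℕ → ℂ := fun i => ∑ j ∈ s, z j * (B j).indicator 1 i
    have hc : ∀ i, ‖c i‖ ≤ 1 := fun i => by
      by_cases h : ∃ j ∈ s, i ∈ B j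
      · obtain ⟨j, hj, hij⟩ := h
        have : c i = z j * (B j).indicator 1 i :=
          Finset.sum_eq_single_of_mem j hj fun l _ hl => by
            rw [Set.indicator_of_notMem, mul_zero]
            exact fun hil => Set.disjoint_left.1 (hB hl) hil hij
        rw [this, norm_mul]
        exact mul_le_one₀ (hz j) (norm_nonneg _) (hind _ _)
      · push Not at h
        have : c i = 0 := Finset.sum_eq_zero fun j hj => by
          rw [Set.indicator_of_notMem (h j hj), mul_zero]
        simp [this]
    obtain ⟨G, hG1, hG⟩ := hex c hc
    suffices h : ∑ j ∈ s, z j • S (B j) = G by rwa [h]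
    ext v
    refine HasSum.unique ?_ (hG v)
    have := hasSum_sum fun j (_ : j ∈ s) => (hS (B j) v).const_smul (z j)
    rw [sum_apply]
    convert this using 2 with i
    · simp only [hg, c, Finset.sum_smul, smul_smul]
    · rfl
  · ext v
    refine (hS _ v).unique ?_
    convert hasSum_single k fun i hi => ?_ using 1
    · simp [hg]
    · simp [hg, hi]

theorem hasQuadraticControl_continuousLinearMap : HasQuadraticControl (H →L[ℂ] H) := by
  intro C hanti hC hsmall δ hδ
  by_contra hcon
  have hU : Uncontrolled C ∅ δ := by
    intro k ψ hψ
    by_contra! hK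
    refine hcon ⟨k, fun y => ψ (star y * y + y * star y), fun x y => ?_,
      fun x => hψ _ (star_mul_self_add_nonneg x), ⟨‖ψ‖ * 2, fun x hx => ?_⟩,
      fun x hx hE φ hφ => hK x hx (fun z hz => hz.elim) hE φ hφ⟩
    · have h : star (x + y) * (x + y) + (x + y) * star (x + y) +
          (star (x - y) * (x - y) + (x - y) * star (x - y)) =
          (star x * x + x * star x) + (star x * x + x * star x) +
          ((star y * y + y * star y) + (star y * y + y * star y)) := by
        rw [star_add, star_sub]
        noncomm_ring
      simp only [two_mul, ← map_add, h]
    · refine (le_abs_self _).trans (ψ.le_opNorm_of_le ?_)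
      refine (norm_add_le _ _).trans ?_
      have h1 := norm_mul_le (star x) x
      have h2 := norm_mul_le x (star x)
      rw [norm_star] at h1 h2
      nlinarith [norm_nonneg x]
  obtain ⟨f, x, φ, hf, hx, horth, hφ, hlt⟩ := hU.exists_orthogonal_blocks hδ hanti hC
  obtain ⟨S, hS, hSk⟩ := exists_isContractiveVectorMeasure hf hx horth
  obtain ⟨k, hk⟩ := hS.exists_norm_apply_singleton_le hanti hC hsmall hφ (half_pos hδ)
  rw [hSk] at hk
  exact (hlt k).not_ge hk

end Hilbert

theorem orthonormal_lp_single :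
    Orthonormal ℂ fun i : ℕ => (lp.single 2 i (1 : ℂ) : lp (fun _ : ℕ => ℂ) 2) := by
  rw [orthonormal_iff_ite]
  intro i j
  rw [lp.inner_single_left]
  simp [lp.single_apply, Pi.single_apply]

end Auxiliary

/-- No bounded linear operator on `L(ℓ₂)`, the complex Banach space of bounded linear
operators on the Hilbert space `ℓ₂` of square-summable complex sequences (with the operator
norm), is topologically transitive. -/
theorem not_topologicallyTransitive_boundedOperators_ell_two
    (T : (lp (fun _ : ℕ => ℂ) 2 →L[ℂ] lp (fun _ : ℕ => ℂ) 2) →L[ℂ]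
         (lp (fun _ : ℕ => ℂ) 2 →L[ℂ] lp (fun _ : ℕ => ℂ) 2)) :
    ¬ TopologicallyTransitive T := by
  intro hT
  obtain ⟨c, hc⟩ := hasQuadraticControl_continuousLinearMap.exists_not_denseRange_sub_smul
    (not_surjective_inclusionInDoubleDual_of_orthonormal _ orthonormal_lp_single) T
  exact hc (hT.denseRange_sub_smul c)
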